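/- arXiv:2307.14992 — 8 statements merged into one kernel-verified Lean document; each statement's English description precedes it below -/
import Mathlib

section
/- Let L be a field of characteristic p that is an 𝔽_q-algebra, θ ∈ L, and n ≥ 1. Let P = (p_{n−1},…,p_0) ∈ C^{⊗n}(L). For 0 ≤ i ≤ n−1 set f_i := Σ_{j=i}^{n−1} C(j,i)·(−θ)^{j−i}·p_j ∈ L, where the binomial coefficients C(j,i) are taken via the canonical map ℤ → L. Then P = Σ_{i=0}^{n−1} φ^i((0,…,0,f_i)), where φ^i denotes the i-th iterate of the endomorphism φ and (0,…,0,f_i) is the vector with last coordinate f_i and all other coordinates 0. -/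
open Polynomial

/-- The `t`-action `φ` on the `n`-th tensor power of the Carlitz module:
`φ(x_1,…,x_n) = (θx_1+x_2, …, θx_{n−1}+x_n, θx_n + x_1^q)`. -/
def carlitzPhi {L : Type*} [Field L] (q n : ℕ) (θ : L) (x : Fin n → L) : Fin n → L :=
  fun i => θ * x i +
    if h : (i : ℕ) + 1 < n then x ⟨(i : ℕ) + 1, h⟩
    else (x ⟨0, Nat.lt_of_le_of_lt (Nat.zero_le _) i.isLt⟩) ^ q

/-- The vector `(0,…,0,α)` whose last coordinate is `α` and whose other coordinates vanish. -/
def lastVec {L : Type*} [Field L] (n : ℕ) (α : L) : Fin n → L :=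
  fun i => if (i : ℕ) = n - 1 then α else 0

theorem iter_lastVec {L : Type*} [Field L] (q n : ℕ) (hq : q ≠ 0) (θ α : L) (i : ℕ) (hi : i < n)
    (k : Fin n) : (carlitzPhi q n θ)^[i] (lastVec n α) k =
      θ ^ (i - (n - 1 - (k : ℕ))) * (i.choose (n - 1 - (k : ℕ)) : L) * α := by
  induction i generalizing k with
  | zero =>
    have hk := k.isLt
    by_cases h : (k : ℕ) = n - 1
    · simp [lastVec, h]
    · have : n - 1 - (k : ℕ) ≠ 0 := by omega
      obtain ⟨m, hm⟩ := Nat.exists_eq_succ_of_ne_zero this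
      simp [lastVec, h, hm]
  | succ i ih =>
    have ih := ih (by omega)
    rw [Function.iterate_succ_apply']
    unfold carlitzPhi
    change θ * ((carlitzPhi q n θ)^[i] (lastVec n α) k) + (if h : (k : ℕ) + 1 < n then
      (carlitzPhi q n θ)^[i] (lastVec n α) ⟨(k : ℕ) + 1, h⟩
      else ((carlitzPhi q n θ)^[i] (lastVec n α) ⟨0, _⟩) ^ q) = _
    have hk := k.isLt
    rw [ih]
    split_ifs with h
    · rw [ih]
      obtain ⟨m, hm⟩ : ∃ m, n - 1 - (k : ℕ) = m + 1 := ⟨n - 1 - (k : ℕ) - 1, by omega⟩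
      have hm' : n - 1 - ((k : ℕ) + 1) = m := by omega
      simp only [hm, hm', Nat.choose_succ_succ, Nat.add_sub_add_right, Nat.cast_add]
      by_cases hmi : m + 1 ≤ i
      · have : i - m = (i - (m + 1)) + 1 := by omega
        rw [this, pow_succ]; ring
      · rw [Nat.choose_eq_zero_of_lt (show i < m + 1 by omega)]
        simp
    · rw [ih]
      have h0 : n - 1 - (k : ℕ) = 0 := by omega
      rw [Nat.choose_eq_zero_of_lt (show i < n - 1 - 0 by omega), h0]
      simp [hq, pow_succ]
      ring

theorem binom_inv {L : Type*} [Field L] (θ : L) (j m : ℕ) :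
    ∑ i ∈ Finset.range (j + 1), θ ^ (i - m) * (i.choose m : L) *
      ((j.choose i : L) * (-θ) ^ (j - i)) = if m = j then 1 else 0 := by
  have h : ((X : L[X]) ^ j) = ((X + C θ) + C (-θ)) ^ j := by simp
  rw [add_pow] at h
  have h2 := congrArg (fun f => coeff f m) h
  simp only [coeff_X_pow, finset_sum_coeff] at h2
  rw [h2]
  refine Finset.sum_congr rfl fun i _ => ?_
  rw [← C_pow, ← C_eq_natCast, coeff_mul_C, coeff_mul_C, coeff_X_add_C_pow]
  ring

/-- Every point `P = (p_{n−1},…,p_0)` of `C^{⊗n}(L)` decomposes as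
`P = Σ_{i=0}^{n−1} φ^i((0,…,0,f_i))` with `f_i = Σ_{j=i}^{n−1} C(j,i)(−θ)^{j−i} p_j`. -/
theorem carlitz_point_decomposition
    (p q e : ℕ) (hp : p.Prime) (he : 0 < e) (hq : q = p ^ e)
    (Fq : Type*) [Field Fq] [Fintype Fq] (hFq : Fintype.card Fq = q)
    (L : Type*) [Field L] [Algebra Fq L] [CharP L p]
    (θ : L) (n : ℕ) (hn : 1 ≤ n) (pc : ℕ → L) :
    (fun i : Fin n => pc (n - 1 - (i : ℕ))) =
      ∑ i ∈ Finset.range n, (carlitzPhi q n θ)^[i]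
        (lastVec n (∑ j ∈ Finset.Icc i (n - 1),
          ((j.choose i : ℤ) : L) * (-θ) ^ (j - i) * pc j)) := by
  have hq0 : q ≠ 0 := by
    rw [hq]; exact pow_ne_zero _ hp.ne_zero
  funext k
  have hk := k.isLt
  rw [Finset.sum_apply]
  rw [Finset.sum_congr rfl fun i hi =>
    iter_lastVec q n hq0 θ _ i (Finset.mem_range.mp hi) k]
  generalize hm : n - 1 - (k : ℕ) = m
  simp only [Finset.mul_sum]
  rw [Finset.sum_comm' (t' := Finset.range n) (s' := fun j => Finset.range (j + 1))
    (by intro x y; simp only [Finset.mem_range, Finset.mem_Icc]; omega)]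
  have : ∀ j ∈ Finset.range n, (∑ i ∈ Finset.range (j + 1), θ ^ (i - m) * (i.choose m : L) *
      (((j.choose i : ℤ) : L) * (-θ) ^ (j - i) * pc j)) = if m = j then pc j else 0 := by
    intro j _
    have := congrArg (· * pc j) (binom_inv θ j m)
    simp only [Finset.sum_mul, ite_mul, one_mul, zero_mul] at this
    rw [← this]
    refine Finset.sum_congr rfl fun i _ => ?_
    push_cast
    ring
  rw [Finset.sum_congr rfl this, Finset.sum_ite_eq, if_pos]
  exact Finset.mem_range.mpr (by omega)
end

section
/- Let L be a field of characteristic p that is an 𝔽_q-algebra, θ ∈ L, and n ≥ 1. Then C^{⊗n}(L) is generated as an 𝔽_q[t]-module by the set of vectors {(0,…,0,α) : α ∈ L} whose first n−1 coordinates vanish; that is, every P ∈ L^n is an 𝔽_q[t]-linear combination (via the action a·x = a(φ)(x)) of such vectors. -/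
open Polynomial

/-- The action of `a ∈ 𝔽_q[t]` on `C^{⊗n}(L)`, namely `a(φ)` applied to `x`; the
coefficients of `a` act through the ring homomorphism `χ : Fq →+* L`. -/
def carlitzAct {Fq L : Type*} [Field Fq] [Field L] (q n : ℕ) (θ : L) (χ : Fq →+* L)
    (a : Polynomial Fq) (x : Fin n → L) : Fin n → L :=
  ∑ i ∈ Finset.range (a.natDegree + 1), χ (a.coeff i) • (carlitzPhi q n θ)^[i] x

theorem carlitz_act_X_pow {Fq L : Type*} [Field Fq] [Field L] (q n : ℕ) (θ : L) (χ : Fq →+* L)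
    (j : ℕ) (x : Fin n → L) :
    carlitzAct q n θ χ (X ^ j) x = (carlitzPhi q n θ)^[j] x := by
  unfold carlitzAct
  rw [natDegree_X_pow, Finset.sum_eq_single j]
  · simp
  · intro b _ hb
    simp [coeff_X_pow, hb]
  · intro h
    simp at h

theorem carlitz_iter_lastVec {L : Type*} [Field L] (q n : ℕ) (θ α : L) (j : ℕ) :
    ∀ i : Fin n, (i : ℕ) + j ≤ n - 1 →
      (carlitzPhi q n θ)^[j] (lastVec n α) i = if (i : ℕ) + j = n - 1 then α else 0 := by
  induction j with
  | zero => intro i _; simp [lastVec]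
  | succ j ih =>
    intro i hi
    have h : (i : ℕ) + 1 < n := by omega
    rw [Function.iterate_succ_apply']
    generalize (carlitzPhi q n θ)^[j] (lastVec n α) = y at ih
    have h1 := ih i (by omega)
    have h2 := ih ⟨(i : ℕ) + 1, h⟩ (by simp; omega)
    rw [if_neg (by omega)] at h1
    simp only [carlitzPhi, dif_pos h, h1, h2, mul_zero, zero_add]
    congr 1
    simp only [eq_iff_iff]
    omega

theorem carlitz_rep {L : Type*} [Field L] (q n : ℕ) (θ : L) (k : ℕ) :
    k ≤ n → ∀ P : Fin n → L, (∀ i : Fin n, (i : ℕ) + k < n → P i = 0) →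
      ∃ α : ℕ → L, P = ∑ j ∈ Finset.range k, (carlitzPhi q n θ)^[j] (lastVec n (α j)) := by
  induction k with
  | zero =>
    intro _ P hP
    exact ⟨0, by ext i; simpa using hP i (by simp)⟩
  | succ k ih =>
    intro hk P hP
    have h0 : n - 1 - k < n := by omega
    set c := P ⟨n - 1 - k, h0⟩ with hc
    obtain ⟨α, hα⟩ := ih (by omega) (P - (carlitzPhi q n θ)^[k] (lastVec n c)) (by
      intro i hi
      rw [Pi.sub_apply, carlitz_iter_lastVec q n θ c k i (by omega)]
      split_ifs with h
      · have : i = ⟨n - 1 - k, h0⟩ := by ext; simp; omega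
        rw [hc, this, sub_self]
      · rw [hP i (by omega), sub_zero])
    refine ⟨Function.update α k c, ?_⟩
    rw [Finset.sum_range_succ, Function.update_self, ← sub_eq_iff_eq_add, hα]
    refine Finset.sum_congr rfl fun j hj => ?_
    rw [Function.update_of_ne (Finset.mem_range.mp hj).ne]

/-- `C^{⊗n}(L)` is generated as an `𝔽_q[t]`-module by the vectors `(0,…,0,α)`, `α ∈ L`:
every point is an `𝔽_q[t]`-linear combination of such vectors. -/
theorem carlitz_tensor_power_generators
    (p q e : ℕ) (hp : p.Prime) (he : 0 < e) (hq : q = p ^ e)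
    (Fq : Type*) [Field Fq] [Fintype Fq] (hFq : Fintype.card Fq = q)
    (L : Type*) [Field L] [Algebra Fq L] [CharP L p]
    (θ : L) (n : ℕ) (hn : 1 ≤ n) (P : Fin n → L) :
    ∃ (m : ℕ) (a : Fin m → Polynomial Fq) (α : Fin m → L),
      P = ∑ i : Fin m, carlitzAct q n θ (algebraMap Fq L) (a i) (lastVec n (α i)) := by
  obtain ⟨α, hα⟩ := carlitz_rep q n θ n le_rfl P (fun i hi => by omega)
  refine ⟨n, fun i => X ^ (i : ℕ), fun i => α i, ?_⟩
  simp only [carlitz_act_X_pow]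
  rw [hα, Finset.sum_range]
end

section
/- Let L be a field of characteristic p that is an 𝔽_q-algebra and let θ ∈ L be transcendental over 𝔽_q. Let n ≥ 1, let P_1,…,P_ℓ ∈ C^{⊗n}(L) with P_i = (p^{[i]}_{n−1},…,p^{[i]}_0), and set f_i := f_{P_i} ∈ L[t]. Then for any a_1,…,a_ℓ ∈ 𝔽_q[t], the following are equivalent: (1) a_1·P_1 + ⋯ + a_ℓ·P_ℓ = 0 in C^{⊗n}(L); (2) there exists g ∈ L[t] such that g^{(1)} − (t−θ)^n·g = a_1 f_1 + ⋯ + a_ℓ f_ℓ in L[t] (where each a_i is viewed in L[t] via 𝔽_q → L). -/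
open Polynomial

/-- The Frobenius twist `h^{(1)}` of a polynomial: each coefficient is raised to
the `q`-th power. -/
noncomputable def twist {L : Type*} [Field L] (q : ℕ) (h : Polynomial L) : Polynomial L :=
  h.sum fun i c => Polynomial.C (c ^ q) * Polynomial.X ^ i

/-- The polynomial `f_P = p_0 + p_1(t−θ) + ⋯ + p_{n−1}(t−θ)^{n−1}` associated to the point
`P = (p_{n−1},…,p_0)` (so `P i.rev` is `p_i`). -/
noncomputable def assocPoly {L : Type*} [Field L] (n : ℕ) (θ : L) (P : Fin n → L) :
    Polynomial L :=
  ∑ i : Fin n, Polynomial.C (P i.rev) * (Polynomial.X - Polynomial.C θ) ^ (i : ℕ)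


noncomputable def czF {L : Type*} [Field L] (n : ℕ) (θ : L) : (Fin n → L) →ₗ[L] L[X] where
  toFun := assocPoly n θ
  map_add' x y := by
    simp [assocPoly, add_mul, Finset.sum_add_distrib]
  map_smul' c x := by
    simp [assocPoly, Finset.mul_sum, mul_assoc, smul_eq_C_mul]

theorem czF_apply {L : Type*} [Field L] (n : ℕ) (θ : L) (x : Fin n → L) :
    czF n θ x = assocPoly n θ x := rfl

theorem cz_inj {L : Type*} [Field L] (n : ℕ) (θ : L) (x : Fin n → L)
    (h : assocPoly n θ x = 0) : x = 0 := by
  have h1 : (assocPoly n θ x).comp (X + C θ) = 0 := by rw [h, zero_comp]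
  have h2 : ∑ i : Fin n, C (x i.rev) * (X : L[X]) ^ (i : ℕ) = 0 := by
    rw [← h1, assocPoly, Polynomial.sum_comp]
    simp
  funext j
  have h3 := congrArg (fun f => coeff f (j.rev : ℕ)) h2
  simp only [finsetSum_coeff, coeff_C_mul_X_pow, coeff_zero, Fin.val_inj] at h3
  simpa using h3

theorem cz_deg {L : Type*} [Field L] (n : ℕ) (θ : L) (x : Fin n → L) :
    (assocPoly n θ x).degree < n := by
  rw [assocPoly, ← mem_degreeLT]
  refine Submodule.sum_mem _ fun i _ => ?_
  rw [mem_degreeLT]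
  refine lt_of_le_of_lt (b := ((i : ℕ) : WithBot ℕ)) ?_ (by exact_mod_cast i.isLt)
  rw [degree_mul, degree_pow, degree_X_sub_C]
  refine le_trans (add_le_add_left degree_C_le _) ?_
  simp

theorem cz_twist {L : Type*} [Field L] (p e : ℕ) [ExpChar L p] (g : L[X]) :
    twist (p ^ e) g = g.map (iterateFrobenius L p e) := by
  rw [twist, Polynomial.map, eval₂_eq_sum]
  rfl

noncomputable def czD {L : Type*} [Field L] (σ : L →+* L) (n : ℕ) (θ : L) : L[X] →+ L[X] :=
  (mapRingHom σ).toAddMonoidHom - AddMonoidHom.mulLeft ((X - C θ) ^ n)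

theorem czD_apply {L : Type*} [Field L] (σ : L →+* L) (n : ℕ) (θ : L) (g : L[X]) :
    czD σ n θ g = g.map σ - (X - C θ) ^ n * g := rfl

theorem cz_zero {L : Type*} [Field L] (σ : L →+* L) (n : ℕ) (hn : 1 ≤ n) (θ : L) (x : Fin n → L)
    (h : assocPoly n θ x ∈ (czD σ n θ).range) : x = 0 := by
  obtain ⟨g, hg⟩ := h
  rw [czD_apply] at hg
  have hd := cz_deg n θ x
  by_cases h0 : g = 0
  · apply cz_inj n θ
    rw [← hg, h0]; simp
  exfalso
  have h1 : ((X - C θ) ^ n * g).degree = ((n + g.natDegree : ℕ) : WithBot ℕ) := by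
    rw [degree_mul, degree_pow, degree_X_sub_C, degree_eq_natDegree h0]
    simp
  have h2 : (g.map σ).degree < ((X - C θ) ^ n * g).degree := by
    rw [h1, degree_map, degree_eq_natDegree h0]
    exact_mod_cast (by omega : g.natDegree < n + g.natDegree)
  rw [← hg, degree_sub_eq_right_of_degree_lt h2, h1] at hd
  have : n + g.natDegree < n := by exact_mod_cast hd
  omega

theorem cz_mul {Fq L : Type*} [Field Fq] [Field L] (σ : L →+* L) (χ : Fq →+* L)
    (hσ : σ.comp χ = χ) (n : ℕ) (θ : L) (b : Fq[X]) (h : L[X])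
    (hh : h ∈ (czD σ n θ).range) : b.map χ * h ∈ (czD σ n θ).range := by
  obtain ⟨g, rfl⟩ := hh
  refine ⟨b.map χ * g, ?_⟩
  rw [czD_apply, czD_apply, Polynomial.map_mul, Polynomial.map_map, hσ]
  ring

theorem cz_phi {L : Type*} [Field L] (q : ℕ) (σ : L →+* L) (hσ : ∀ x, σ x = x ^ q)
    (n : ℕ) (hn : 1 ≤ n) (θ : L) (x : Fin n → L) :
    assocPoly n θ (carlitzPhi q n θ x) - X * assocPoly n θ x ∈ (czD σ n θ).range := by
  obtain ⟨m, rfl⟩ : ∃ m, n = m + 1 := ⟨n - 1, by omega⟩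
  have key : ∀ y : Fin (m+1) → L, assocPoly (m+1) θ y
      = ∑ i : Fin (m+1), C (y i) * (X - C θ) ^ (m - (i : ℕ)) := by
    intro y
    rw [assocPoly, ← Equiv.sum_comp Fin.revPerm]
    refine Finset.sum_congr rfl fun i _ => ?_
    simp [Fin.val_rev]
  refine ⟨C (x 0), ?_⟩
  have e1 : assocPoly (m+1) θ (carlitzPhi q (m+1) θ x) = C θ * assocPoly (m+1) θ x
      + ((∑ i : Fin m, C (x i.succ) * (X - C θ) ^ (m - (i : ℕ))) + C (x 0 ^ q)) := by
    have : carlitzPhi q (m+1) θ x = θ • x +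
        (fun i : Fin (m+1) => if h : (i : ℕ) + 1 < m+1 then x ⟨(i : ℕ) + 1, h⟩ else x 0 ^ q) := rfl
    rw [this, ← czF_apply, map_add, map_smul, czF_apply, czF_apply, smul_eq_C_mul]
    congr 1
    rw [key, Fin.sum_univ_castSucc]
    simp [Fin.succ]
  have e2 : (X - C θ) * assocPoly (m+1) θ x = C (x 0) * (X - C θ) ^ (m+1) +
      ∑ i : Fin m, C (x i.succ) * (X - C θ) ^ (m - (i : ℕ)) := by
    rw [key, Fin.sum_univ_succ, mul_add, Finset.mul_sum]
    congr 1
    · simp; ring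
    · refine Finset.sum_congr rfl fun i _ => ?_
      have : m - (i : ℕ) = (m - (i.succ : ℕ)) + 1 := by
        have := i.isLt
        simp; omega
      rw [this]; ring
  rw [czD_apply, e1, map_C, hσ]
  linear_combination e2

theorem cz_iter {L : Type*} [Field L] (q : ℕ) (σ : L →+* L) (hσ : ∀ x, σ x = x ^ q)
    (n : ℕ) (hn : 1 ≤ n) (θ : L) (x : Fin n → L) (k : ℕ) :
    assocPoly n θ ((carlitzPhi q n θ)^[k] x) - X ^ k * assocPoly n θ x ∈ (czD σ n θ).range := by
  induction k with
  | zero => simp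
  | succ k ih =>
    rw [Function.iterate_succ_apply']
    have h1 := cz_phi q σ hσ n hn θ ((carlitzPhi q n θ)^[k] x)
    obtain ⟨g, hg⟩ := ih
    have h2 : X * (assocPoly n θ ((carlitzPhi q n θ)^[k] x) - X ^ k * assocPoly n θ x)
        ∈ (czD σ n θ).range := by
      refine ⟨X * g, ?_⟩
      rw [← hg, czD_apply, czD_apply, Polynomial.map_mul, map_X]
      ring
    convert add_mem h1 h2 using 1
    ring

theorem cz_act {Fq L : Type*} [Field Fq] [Field L] (q : ℕ) (σ : L →+* L)
    (hσ : ∀ x, σ x = x ^ q) (χ : Fq →+* L) (hχ : σ.comp χ = χ)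
    (n : ℕ) (hn : 1 ≤ n) (θ : L) (b : Fq[X]) (x : Fin n → L) :
    assocPoly n θ (carlitzAct q n θ χ b x) - b.map χ * assocPoly n θ x
      ∈ (czD σ n θ).range := by
  have e1 : b.map χ = ∑ i ∈ Finset.range (b.natDegree + 1), C (χ (b.coeff i)) * X ^ i := by
    conv_lhs => rw [b.as_sum_range_C_mul_X_pow]
    simp [Polynomial.map_sum]
  rw [carlitzAct, ← czF_apply, map_sum, e1, Finset.sum_mul, ← Finset.sum_sub_distrib]
  refine sum_mem fun i _ => ?_
  have := cz_mul σ χ hχ n θ (C (b.coeff i)) _ (cz_iter q σ hσ n hn θ x i)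
  rw [map_smul, smul_eq_C_mul, czF_apply]
  convert this using 1
  rw [map_C]; ring

/-- `Σ a_i·P_i = 0` in `C^{⊗n}(L)` iff the Frobenius difference equation
`g^{(1)} − (t−θ)^n g = Σ a_i f_{P_i}` has a solution `g ∈ L[t]`. -/
theorem carlitz_relation_iff_difference_equation
    (p q e : ℕ) (hp : p.Prime) (he : 0 < e) (hq : q = p ^ e)
    (Fq : Type*) [Field Fq] [Fintype Fq] (hFq : Fintype.card Fq = q)
    (L : Type*) [Field L] [Algebra Fq L] [CharP L p]
    (θ : L) (hθ : Transcendental Fq θ)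
    (n : ℕ) (hn : 1 ≤ n) (ℓ : ℕ) (P : Fin ℓ → Fin n → L)
    (a : Fin ℓ → Polynomial Fq) :
    (∑ i : Fin ℓ, carlitzAct q n θ (algebraMap Fq L) (a i) (P i) = 0) ↔
      ∃ g : Polynomial L,
        twist q g - (Polynomial.X - Polynomial.C θ) ^ n * g =
          ∑ i : Fin ℓ, ((a i).map (algebraMap Fq L)) * assocPoly n θ (P i) := by
  haveI : Fact p.Prime := ⟨hp⟩
  subst hq
  set σ := iterateFrobenius L p e with hσd
  have hσ : ∀ x, σ x = x ^ (p ^ e) := fun x => rfl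
  have hχ : σ.comp (algebraMap Fq L) = algebraMap Fq L := by
    ext c
    rw [RingHom.comp_apply, hσ, ← map_pow, ← hFq, FiniteField.pow_card]
  have hmain : assocPoly n θ (∑ i, carlitzAct (p ^ e) n θ (algebraMap Fq L) (a i) (P i))
      - ∑ i : Fin ℓ, ((a i).map (algebraMap Fq L)) * assocPoly n θ (P i)
      ∈ (czD σ n θ).range := by
    rw [← czF_apply, map_sum, ← Finset.sum_sub_distrib]
    exact sum_mem fun i _ => cz_act _ σ hσ _ hχ n hn θ _ _
  have hR : (∃ g : Polynomial L, twist (p ^ e) g - (Polynomial.X - Polynomial.C θ) ^ n * g =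
      ∑ i : Fin ℓ, ((a i).map (algebraMap Fq L)) * assocPoly n θ (P i)) ↔
      ∑ i : Fin ℓ, ((a i).map (algebraMap Fq L)) * assocPoly n θ (P i)
        ∈ (czD σ n θ).range := by
    simp only [cz_twist]
    rfl
  rw [hR]
  constructor
  · intro h
    rw [h, ← czF_apply, map_zero, zero_sub] at hmain
    exact neg_mem_iff.mp hmain
  · intro h
    apply cz_zero σ n hn θ
    simpa using add_mem hmain h
end

section
/- Let L ⊆ K be an extension of fields of characteristic p, let θ ∈ L, and let n ≥ 1. If g ∈ K[t] is such that every coefficient of g^{(1)} − (t−θ)^n·g lies in L, then every coefficient of g lies in L. -/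
open Polynomial

theorem twist_coeff_aux {L : Type*} [Field L] (q : ℕ) (hq : q ≠ 0) (h : Polynomial L) (i : ℕ) :
    (twist q h).coeff i = h.coeff i ^ q := by
  unfold twist
  rw [Polynomial.sum_def, Polynomial.finsetSum_coeff]
  simp only [Polynomial.coeff_C_mul_X_pow]
  rw [Finset.sum_ite_eq]
  split_ifs with h1
  · rfl
  · rw [Polynomial.notMem_support_iff.mp h1, zero_pow hq]

/-- If `g ∈ K[t]` and every coefficient of `g^{(1)} − (t−θ)^n g` lies in the subfield `L`
(with `θ ∈ L`), then every coefficient of `g` lies in `L`. -/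
theorem coefficients_descend_of_difference_equation
    (p q e : ℕ) (hp : p.Prime) (he : 0 < e) (hq : q = p ^ e)
    (L K : Type*) [Field L] [Field K] [Algebra L K] [CharP L p] [CharP K p]
    (θ : L) (n : ℕ) (hn : 1 ≤ n) (g : Polynomial K)
    (hg : ∀ i : ℕ,
      (twist q g - (Polynomial.X - Polynomial.C (algebraMap L K θ)) ^ n * g).coeff i ∈
        (algebraMap L K).range) :
    ∀ i : ℕ, g.coeff i ∈ (algebraMap L K).range := by
  have hq0 : q ≠ 0 := by
    rw [hq]; exact pow_ne_zero _ hp.ne_zero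
  set R := (algebraMap L K).range with hR
  set P : Polynomial K := (Polynomial.X - Polynomial.C (algebraMap L K θ)) ^ n with hP
  have hmon : P.Monic := (Polynomial.monic_X_sub_C _).pow n
  have hdeg : P.natDegree = n := by
    rw [hP, Polynomial.natDegree_pow, Polynomial.natDegree_X_sub_C, mul_one]
  have hPn : P.coeff n = 1 := by
    have := hmon.coeff_natDegree
    rwa [hdeg] at this
  have hPR : ∀ a, P.coeff a ∈ R := by
    intro a
    have : P = ((Polynomial.X - Polynomial.C θ) ^ n).map (algebraMap L K) := by
      simp [hP]
    rw [this, Polynomial.coeff_map]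
    exact ⟨_, rfl⟩
  have key : ∀ k i : ℕ, g.natDegree < i + k → g.coeff i ∈ R := by
    intro k
    induction k with
    | zero =>
      intro i hi
      rw [Polynomial.coeff_eq_zero_of_natDegree_lt (by omega : g.natDegree < i)]
      exact R.zero_mem
    | succ k ih =>
      intro i hi
      have h1 := hg (n + i)
      rw [Polynomial.coeff_sub, twist_coeff_aux q hq0, Polynomial.coeff_mul,
        ← Finset.add_sum_erase _ _ (Finset.HasAntidiagonal.mem_antidiagonal.mpr (rfl : (n, i).1 + (n, i).2 = n + i))]
        at h1
      simp only [hPn, one_mul] at h1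
      have h2 : g.coeff (n + i) ^ q ∈ R := R.pow_mem (ih _ (by omega)) q
      have h3 : ∑ x ∈ (Finset.HasAntidiagonal.antidiagonal (n + i)).erase (n, i),
          P.coeff x.1 * g.coeff x.2 ∈ R := by
        refine R.sum_mem ?_
        rintro ⟨a, b⟩ hab
        rw [Finset.mem_erase, Finset.HasAntidiagonal.mem_antidiagonal] at hab
        obtain ⟨hne, hs⟩ := hab
        simp only at hs
        rcases lt_trichotomy a n with h | h | h
        · exact R.mul_mem (hPR a) (ih b (by omega))
        · exact absurd (Prod.ext h (by simp only; omega)) hne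
        · have : P.coeff a = 0 := Polynomial.coeff_eq_zero_of_natDegree_lt (by omega)
          simp only [this, zero_mul]
          exact R.zero_mem
      have h4 := R.sub_mem (R.sub_mem h2 h1) h3
      convert h4 using 1
      ring
  intro i
  exact key (g.natDegree + 1) i (by omega)
end

section
/- Let K be an algebraically closed field of characteristic p containing 𝔽_q, let θ ∈ K be transcendental over 𝔽_q, and let n ≥ 1. Then for every f ∈ K[t] there exists a unique polynomial r ∈ K[t] with deg r < n for which there exists g ∈ K[t] with f − r = (t−θ)^n·g − g^{(1)}. -/
open Polynomial

theorem twist_eq_map_aux {K : Type*} [Field K] (p e : ℕ) [Fact p.Prime] [CharP K p]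
    (h : Polynomial K) : twist (p ^ e) h = h.map (iterateFrobenius K p e) := by
  unfold twist
  rw [Polynomial.map, Polynomial.eval₂_eq_sum]
  simp [iterateFrobenius_def]

theorem exists_rem_aux {K : Type*} [Field K] (φ : K →+* K) (M : Polynomial K) (hM : M.Monic)
    (n : ℕ) (hn : 1 ≤ n) (hMn : M.natDegree = n) (d : ℕ) :
    ∀ f : Polynomial K, f.degree < (d : WithBot ℕ) → ∃ r : Polynomial K,
      r.degree < (n : WithBot ℕ) ∧ ∃ g : Polynomial K, f - r = M * g - g.map φ := by
  induction d with
  | zero =>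
    intro f hf
    exact ⟨f, hf.trans_le (by exact_mod_cast Nat.zero_le n), 0, by simp⟩
  | succ d ih =>
    intro f hf
    rcases Nat.lt_or_ge d n with h | h
    · exact ⟨f, hf.trans_le (by exact_mod_cast h), 0, by simp⟩
    · obtain ⟨r, hr, g, hg⟩ := ih
        (f - (M * (C (f.coeff d) * X ^ (d - n)) - (C (f.coeff d) * X ^ (d - n)).map φ)) (by
          rw [degree_lt_iff_coeff_zero] at hf ⊢
          intro m hm
          have e1 : (M * (C (f.coeff d) * X ^ (d - n))).coeff m
              = f.coeff d * M.coeff (m - (d - n)) := by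
            rw [mul_left_comm, coeff_C_mul, coeff_mul_X_pow', if_pos (by omega)]
          have e2 : ((C (f.coeff d) * X ^ (d - n)).map φ).coeff m = 0 := by
            rw [coeff_map, coeff_C_mul, coeff_X_pow, if_neg (by omega)]
            simp
          rw [coeff_sub, coeff_sub, e1, e2]
          rcases hm.eq_or_lt with rfl | hlt
          · have : d - (d - n) = M.natDegree := by omega
            rw [this, hM.coeff_natDegree]
            simp
          · rw [hf m hlt, coeff_eq_zero_of_natDegree_lt (p := M) (by omega)]
            simp)
      refine ⟨r, hr, g + C (f.coeff d) * X ^ (d - n), ?_⟩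
      rw [Polynomial.map_add]
      linear_combination hg

theorem degree_aux {K : Type*} [Field K] (φ : K →+* K) (M : Polynomial K) (hM : M.Monic)
    (n : ℕ) (hn : 1 ≤ n) (hMn : M.natDegree = n) (g : Polynomial K)
    (h : (M * g - g.map φ).degree < (n : WithBot ℕ)) : g = 0 := by
  by_contra hg
  rw [degree_lt_iff_coeff_zero] at h
  have := h (n + g.natDegree) (by omega)
  rw [coeff_sub, ← hMn, coeff_mul_degree_add_degree, coeff_map,
    coeff_eq_zero_of_natDegree_lt (p := g) (by omega), hM.leadingCoeff] at this
  simp [hg] at this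

/-- Over an algebraically closed field `K` of characteristic `p` containing `𝔽_q`, with
`θ` transcendental over `𝔽_q`, every `f ∈ K[t]` has a unique remainder `r` with
`deg r < n` modulo the image of `g ↦ (t−θ)^n g − g^{(1)}`. -/
theorem unique_remainder_modulo_difference_operator
    (p q e : ℕ) (hp : p.Prime) (he : 0 < e) (hq : q = p ^ e)
    (Fq : Type*) [Field Fq] [Fintype Fq] (hFq : Fintype.card Fq = q)
    (K : Type*) [Field K] [IsAlgClosed K] [Algebra Fq K] [CharP K p]
    (θ : K) (hθ : Transcendental Fq θ) (n : ℕ) (hn : 1 ≤ n) (f : Polynomial K) :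
    ∃! r : Polynomial K, r.degree < (n : WithBot ℕ) ∧
      ∃ g : Polynomial K,
        f - r = (Polynomial.X - Polynomial.C θ) ^ n * g - twist q g := by
  have : Fact p.Prime := ⟨hp⟩
  subst hq
  simp only [twist_eq_map_aux]
  have hM : ((X - C θ) ^ n).Monic := (monic_X_sub_C θ).pow n
  have hMn : ((X - C θ) ^ n).natDegree = n := by
    rw [(monic_X_sub_C θ).natDegree_pow, natDegree_X_sub_C, mul_one]
  obtain ⟨r, hr, g, hg⟩ := exists_rem_aux (iterateFrobenius K p e) _ hM n hn hMn
    (f.natDegree + 1) f (by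
      rw [degree_lt_iff_coeff_zero]
      intro m hm
      exact coeff_eq_zero_of_natDegree_lt (by omega))
  refine ⟨r, ⟨hr, g, hg⟩, ?_⟩
  rintro s ⟨hs, k, hk⟩
  have key : (X - C θ) ^ n * (k - g) - (k - g).map (iterateFrobenius K p e) = r - s := by
    rw [Polynomial.map_sub]
    linear_combination hg - hk
  have h0 := degree_aux (iterateFrobenius K p e) _ hM n hn hMn (k - g) (by
    rw [key]
    exact (degree_sub_le r s).trans_lt (max_lt hr hs))
  rw [h0] at key
  simp at key
  exact (sub_eq_zero.mp key.symm).symm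
end

section
/- Let K be a field of characteristic p, let v be an additive valuation on K, let θ ∈ K, let n ≥ 1, and set m := min(0, v(θ)). If g, F ∈ K[t] satisfy g^{(1)} − (t−θ)^n·g = F, then ord_v(g) ≥ min( ord_v(F) − n·m , ⌈n/(q−1)⌉·m ), where ⌈·⌉ denotes the ceiling. -/
open Polynomial

/-- An additive valuation on a field `K`: a map `v : K → ℤ ∪ {∞}` with `v x = ∞` iff `x = 0`,
`v(xy) = v x + v y` and `v(x+y) ≥ min (v x) (v y)`. -/
structure AddVal (K : Type*) [Field K] where
  v : K → WithTop ℤ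
  eq_top_iff : ∀ x, v x = ⊤ ↔ x = 0
  map_mul : ∀ x y, v (x * y) = v x + v y
  add_le : ∀ x y, min (v x) (v y) ≤ v (x + y)

/-- `ord_v` of a polynomial: the minimum of `v` over its coefficients (`∞` for `0`). -/
noncomputable def ordv {K : Type*} [Field K] (w : AddVal K) (h : Polynomial K) : WithTop ℤ :=
  (Finset.range (h.natDegree + 1)).inf fun i => w.v (h.coeff i)

theorem AddVal.map_one' {K : Type*} [Field K] (w : AddVal K) : w.v 1 = 0 := by
  have h1 := w.map_mul 1 1
  have h2 : w.v 1 ≠ ⊤ := by rw [Ne, w.eq_top_iff]; exact one_ne_zero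
  rw [mul_one] at h1
  lift w.v 1 to ℤ using h2 with a
  norm_cast at h1 ⊢
  omega

noncomputable def AddVal.toAV {K : Type*} [Field K] (w : AddVal K) :
    AddValuation K (WithTop ℤ) :=
  AddValuation.of w.v ((w.eq_top_iff 0).2 rfl) w.map_one' w.add_le w.map_mul

theorem AddVal.toAV_apply {K : Type*} [Field K] (w : AddVal K) (x : K) :
    w.toAV x = w.v x := rfl

theorem le_ordv_iff {K : Type*} [Field K] (w : AddVal K) (h : Polynomial K) (b : WithTop ℤ) :
    b ≤ ordv w h ↔ ∀ i, b ≤ w.v (h.coeff i) := by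
  unfold ordv
  rw [Finset.le_inf_iff]
  constructor
  · intro H i
    by_cases hi : i < h.natDegree + 1
    · exact H i (Finset.mem_range.2 hi)
    · rw [Polynomial.coeff_eq_zero_of_natDegree_lt (by omega), (w.eq_top_iff 0).2 rfl]
      exact le_top
  · intro H i _
    exact H i

theorem coeff_twist {K : Type*} [Field K] (q : ℕ) (hq : q ≠ 0) (h : Polynomial K) (i : ℕ) :
    (twist q h).coeff i = h.coeff i ^ q := by
  unfold twist
  rw [Polynomial.sum_def, Polynomial.finset_sum_coeff]
  simp only [Polynomial.coeff_C_mul, Polynomial.coeff_X_pow, mul_ite, mul_one, mul_zero]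
  rw [Finset.sum_ite_eq]
  split_ifs with hi
  · rfl
  · rw [Polynomial.notMem_support_iff.1 hi, zero_pow hq]

theorem le_ordv_mul {K : Type*} [Field K] (w : AddVal K) (θ : K) (m : ℤ)
    (hm : (m : WithTop ℤ) = min 0 (w.v θ)) (h : Polynomial K) (b : ℤ)
    (H : ∀ i, (b : WithTop ℤ) ≤ w.v (h.coeff i)) (i : ℕ) :
    ((m + b : ℤ) : WithTop ℤ) ≤ w.v (((Polynomial.X - Polynomial.C θ) * h).coeff i) := by
  have m0 : (m : WithTop ℤ) ≤ 0 := hm ▸ min_le_left _ _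
  have mθ : (m : WithTop ℤ) ≤ w.v θ := hm ▸ min_le_right _ _
  rw [sub_mul, Polynomial.coeff_sub, Polynomial.coeff_C_mul, ← w.toAV_apply]
  refine AddValuation.map_le_sub _ ?_ ?_
  · rw [w.toAV_apply]
    cases i with
    | zero =>
      rw [Polynomial.coeff_X_mul_zero, (w.eq_top_iff 0).2 rfl]
      exact le_top
    | succ i =>
      rw [Polynomial.coeff_X_mul]
      refine le_trans ?_ (H i)
      norm_cast at m0 ⊢
      omega
  · rw [w.toAV_apply, w.map_mul, WithTop.coe_add]
    exact add_le_add mθ (H i)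

theorem le_ordv_pow_mul {K : Type*} [Field K] (w : AddVal K) (θ : K) (m : ℤ)
    (hm : (m : WithTop ℤ) = min 0 (w.v θ)) (h : Polynomial K) (b : ℤ)
    (H : ∀ i, (b : WithTop ℤ) ≤ w.v (h.coeff i)) (n : ℕ) : ∀ (i : ℕ),
    ((n * m + b : ℤ) : WithTop ℤ) ≤ w.v (((Polynomial.X - Polynomial.C θ) ^ n * h).coeff i) := by
  induction n with
  | zero => simpa using H
  | succ n ih =>
    intro i
    have := le_ordv_mul w θ m hm _ _ ih i
    rw [pow_succ', mul_assoc]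
    convert this using 2
    push_cast
    ring

/-- If `g^{(1)} − (t−θ)^n g = F` and `m = min(0, v θ)`, then
`ord_v g ≥ min(ord_v F − n·m, ⌈n/(q−1)⌉·m)`. -/
theorem ordv_lower_bound_of_difference_equation
    (p q e : ℕ) (hp : p.Prime) (he : 0 < e) (hq : q = p ^ e)
    (K : Type*) [Field K] [CharP K p] (w : AddVal K)
    (θ : K) (n : ℕ) (hn : 1 ≤ n)
    (m : ℤ) (hm : (m : WithTop ℤ) = min 0 (w.v θ))
    (g F : Polynomial K)
    (hgF : twist q g - (Polynomial.X - Polynomial.C θ) ^ n * g = F) :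
    min (ordv w F + ((-((n : ℤ) * m) : ℤ) : WithTop ℤ))
        (((⌈(n : ℚ) / ((q : ℚ) - 1)⌉ * m : ℤ) : WithTop ℤ)) ≤ ordv w g := by
  have hq2 : 2 ≤ q := by
    rw [hq]
    exact le_trans hp.two_le (Nat.le_self_pow he.ne' p)
  have m0 : m ≤ 0 := by
    have : (m : WithTop ℤ) ≤ 0 := hm ▸ min_le_left _ _
    exact_mod_cast this
  by_cases hg : ordv w g = ⊤
  · rw [hg]; exact le_top
  obtain ⟨i, -, hi⟩ := Finset.exists_mem_eq_inf (Finset.range (g.natDegree + 1))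
    ⟨0, Finset.mem_range.2 (Nat.succ_pos _)⟩ (fun i => w.v (g.coeff i))
  change ordv w g = w.v (g.coeff i) at hi
  have hall := (le_ordv_iff w g _).1 le_rfl
  lift ordv w g to ℤ using hg with a
  have hpow := le_ordv_pow_mul w θ m hm g a hall n i
  by_cases hF : ((n * m + a : ℤ) : WithTop ℤ) ≤ ordv w F
  · refine le_trans (min_le_right _ _) ?_
    have hFi := (le_ordv_iff w F _).1 hF i
    have htw : twist q g = F + (Polynomial.X - Polynomial.C θ) ^ n * g := by
      rw [← hgF]; ring
    have hc := coeff_twist q (by omega) g i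
    rw [htw, Polynomial.coeff_add] at hc
    have h1 := AddValuation.map_le_add w.toAV hFi hpow
    rw [hc, AddValuation.map_pow, w.toAV_apply, ← hi] at h1
    have h2 : (n * m + a : ℤ) ≤ q * a := by
      rw [← nsmul_eq_mul q a]
      exact_mod_cast h1
    have hq1 : (0 : ℚ) < (q : ℚ) - 1 := by
      have : (2 : ℚ) ≤ q := by exact_mod_cast hq2
      linarith
    have h3 : (n : ℚ) * m + a ≤ q * a := by exact_mod_cast h2
    have h4 := Int.le_ceil ((n : ℚ) / ((q : ℚ) - 1))
    have h5 : (m : ℚ) ≤ 0 := by exact_mod_cast m0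
    have h6 := mul_le_mul_of_nonpos_right h4 h5
    have h7 : (n : ℚ) / ((q : ℚ) - 1) * m ≤ a := by
      rw [div_mul_eq_mul_div, div_le_iff₀ hq1]
      linarith
    have h8 := h6.trans h7
    exact_mod_cast h8
  · refine le_trans (min_le_left _ _) ?_
    have hF' := (not_le.1 hF)
    lift ordv w F to ℤ using hF'.ne_top with f
    norm_cast at hF' ⊢
    omega
end

section
/- Let k = 𝔽_q(θ) be the rational function field and n ≥ 1. The family of points P_π := (0,…,0, π^{−1}) ∈ C^{⊗n}(k), indexed by the monic irreducible polynomials π ∈ 𝔽_q[θ], is linearly independent over 𝔽_q[t]: for any finitely many distinct monic irreducibles π_1,…,π_ℓ and a_1,…,a_ℓ ∈ 𝔽_q[t], if a_1·P_{π_1} + ⋯ + a_ℓ·P_{π_ℓ} = 0 in C^{⊗n}(k) then all a_i = 0. In particular, the 𝔽_q[t]-module C^{⊗n}(k) contains a free 𝔽_q[t]-submodule of countably infinite rank. -/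
open Polynomial

section helpers

variable {L Γ : Type*} [Field L] [LinearOrderedCommGroupWithZero Γ]

/-- bound -/
def czB (c : Γ) (q : ℕ) : ℕ → Γ
  | 0 => 1
  | j + 1 => c ^ (q ^ j)

theorem czB_lt (c : Γ) (hc : 1 < c) (q : ℕ) (hq : 2 ≤ q) (j : ℕ) :
    czB c q j < czB c q (j + 1) := by
  cases j with
  | zero => simpa [czB] using hc
  | succ j =>
    simp only [czB]
    exact pow_lt_pow_right₀ hc (Nat.pow_lt_pow_right hq (Nat.lt_succ_self j))

theorem czB_mono (c : Γ) (hc : 1 < c) (q : ℕ) (hq : 2 ≤ q) : StrictMono (czB c q) :=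
  strictMono_nat_of_lt_succ (czB_lt c hc q hq)

theorem czB_pow_le (c : Γ) (hc : 1 < c) (q j : ℕ) : czB c q j ^ q ≤ czB c q (j + 1) := by
  cases j with
  | zero => simpa [czB] using hc.le
  | succ j => simp [czB, ← pow_mul, pow_succ]

theorem czB_pow_eq (c : Γ) (q j : ℕ) (hj : 0 < j) : czB c q j ^ q = czB c q (j + 1) := by
  cases j with
  | zero => omega
  | succ j => simp [czB, ← pow_mul, pow_succ]

theorem cz_div_lt (n m : ℕ) (hn : 1 ≤ n) (h : n ∣ m + 1) : m / n < (m + 1) / n := by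
  rw [Nat.succ_div, if_pos h]; omega

theorem cz_iter_s10 (v : Valuation L Γ) (q n : ℕ) (hq : 2 ≤ q) (hn : 1 ≤ n) (θ α : L)
    (hθ : v θ ≤ 1) (hα : 1 < v α) (d : ℕ) (i : Fin n) :
    v ((carlitzPhi q n θ)^[d] (lastVec n α) i) ≤ czB (v α) q ((d + i + 1) / n) ∧
    (n ∣ d + i + 1 →
      v ((carlitzPhi q n θ)^[d] (lastVec n α) i) = czB (v α) q ((d + i + 1) / n)) := by
  have hmono := czB_mono (v α) hα q hq
  have hpos : ∀ j, 0 < czB (v α) q j := fun j =>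
    lt_of_lt_of_le zero_lt_one (hmono.monotone (Nat.zero_le j))
  induction d generalizing i with
  | zero =>
    simp only [Function.iterate_zero, id, lastVec, Nat.zero_add]
    by_cases hi : (i : ℕ) = n - 1
    · have : (i : ℕ) + 1 = n := by omega
      rw [if_pos hi, this, Nat.div_self (by omega)]
      simp [czB]
    · rw [if_neg hi]
      refine ⟨by simp, fun h => ?_⟩
      have := Nat.le_of_dvd (by omega) h
      omega
  | succ d ih =>
    rw [Function.iterate_succ_apply']
    set x := (carlitzPhi q n θ)^[d] (lastVec n α) with hx
    have h1 : v (θ * x i) ≤ czB (v α) q ((d + i + 1) / n) := by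
      rw [map_mul]
      exact (mul_le_of_le_one_left' hθ).trans (ih i).1
    have key : ∃ y, carlitzPhi q n θ x i = θ * x i + y ∧
        v y ≤ czB (v α) q ((d + i + 1 + 1) / n) ∧
        (n ∣ d + i + 1 + 1 → v y = czB (v α) q ((d + i + 1 + 1) / n)) := by
      by_cases h : (i : ℕ) + 1 < n
      · refine ⟨_, by simp only [carlitzPhi]; rw [dif_pos h], ?_⟩
        exact ih ⟨i + 1, h⟩
      · refine ⟨_, by simp only [carlitzPhi]; rw [dif_neg h], ?_⟩
        have hi : d + i + 1 + 1 = d + 1 + n := by have := i.isLt; omega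
        have ih0 := ih ⟨0, by omega⟩
        simp only [Nat.add_zero] at ih0
        rw [hi, Nat.add_div_right _ (by omega), map_pow]
        refine ⟨(pow_le_pow_left₀ zero_le' ih0.1 q).trans (czB_pow_le _ hα _ _), fun hd => ?_⟩
        have hd' : n ∣ d + 1 := (Nat.dvd_add_left (dvd_refl n)).1 hd
        rw [ih0.2 hd', czB_pow_eq]
        exact Nat.div_pos (Nat.le_of_dvd (by omega) hd') (by omega)
    obtain ⟨y, hy, hy1, hy2⟩ := key
    have e : d + 1 + (i : ℕ) + 1 = d + i + 1 + 1 := by omega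
    rw [hy, e]
    refine ⟨v.map_add_le (h1.trans (hmono.monotone (Nat.div_le_div_right (by omega)))) hy1,
      fun hd => ?_⟩
    rw [← hy2 hd]
    apply Valuation.map_add_eq_of_lt_right
    rw [hy2 hd]
    exact h1.trans_lt (hmono (cz_div_lt _ _ hn hd))

theorem cz_integral (v : Valuation L Γ) (q n : ℕ) (θ : L) (hθ : v θ ≤ 1) (x : Fin n → L)
    (hx : ∀ i, v (x i) ≤ 1) (d : ℕ) (i : Fin n) : v ((carlitzPhi q n θ)^[d] x i) ≤ 1 := by
  induction d generalizing i with
  | zero => exact hx i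
  | succ d ih =>
    rw [Function.iterate_succ_apply']
    simp only [carlitzPhi]
    refine v.map_add_le ?_ ?_
    · rw [map_mul]; exact mul_le_one' hθ (ih i)
    · split_ifs
      · exact ih _
      · rw [map_pow]; exact pow_le_one' (ih _) q

theorem cz_act_integral {Fq : Type*} [Field Fq] (v : Valuation L Γ) (q n : ℕ) (θ : L)
    (χ : Fq →+* L) (hχ : ∀ c, v (χ c) ≤ 1) (hθ : v θ ≤ 1) (x : Fin n → L)
    (hx : ∀ i, v (x i) ≤ 1) (a : Polynomial Fq) (i : Fin n) :
    v (carlitzAct q n θ χ a x i) ≤ 1 := by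
  rw [carlitzAct, Finset.sum_apply]
  refine v.map_sum_le fun j _ => ?_
  rw [Pi.smul_apply, smul_eq_mul, map_mul]
  exact mul_le_one' (hχ _) (cz_integral v q n θ hθ x hx j i)

theorem cz_act_pole {Fq : Type*} [Field Fq] (v : Valuation L Γ) (q n : ℕ) (hq : 2 ≤ q)
    (hn : 1 ≤ n) (θ α : L) (χ : Fq →+* L) (hχ : ∀ c, v (χ c) ≤ 1) (hθ : v θ ≤ 1)
    (hα : 1 < v α) (a : Polynomial Fq) (ha : a ≠ 0) :
    ∃ i, 1 < v (carlitzAct q n θ χ a (lastVec n α) i) := by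
  have hmono := czB_mono (v α) hα q hq
  have hpos : ∀ j, 0 < czB (v α) q j := fun j =>
    lt_of_lt_of_le zero_lt_one (hmono.monotone (Nat.zero_le j))
  set d := a.natDegree with hd
  have hlt : n - 1 - d % n < n := by omega
  have hdvd : n ∣ d + (n - 1 - d % n) + 1 := by
    have h1 := Nat.div_add_mod d n
    have h2 := Nat.mod_lt d (show n > 0 by omega)
    refine ⟨d / n + 1, ?_⟩
    rw [mul_add]; omega
  set i : Fin n := ⟨n - 1 - d % n, hlt⟩ with hi
  have hdvd' : n ∣ d + (i : ℕ) + 1 := hdvd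
  refine ⟨i, ?_⟩
  have hlead : v (χ (a.coeff d)) = 1 := by
    have hne : a.coeff d ≠ 0 := by simpa [hd] using ha
    refine le_antisymm (hχ _) ?_
    have h := hχ (a.coeff d)⁻¹
    rw [map_inv₀, map_inv₀] at h
    have h0 : v (χ (a.coeff d)) ≠ 0 := by simpa using hne
    exact (inv_le_one₀ (zero_lt_iff.2 h0)).1 h
  have htop : v (χ (a.coeff d) * (carlitzPhi q n θ)^[d] (lastVec n α) i)
      = czB (v α) q ((d + i + 1) / n) := by
    rw [map_mul, hlead, one_mul]
    exact (cz_iter_s10 v q n hq hn θ α hθ hα d i).2 hdvd'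
  rw [carlitzAct, Finset.sum_apply, Finset.sum_range_succ]
  simp only [Pi.smul_apply, smul_eq_mul]
  rw [Valuation.map_add_eq_of_lt_right, htop]
  · have : 0 < (d + i + 1) / n := Nat.div_pos (Nat.le_of_dvd (by omega) hdvd') (by omega)
    simpa [czB] using hmono this
  · rw [htop]
    refine v.map_sum_lt (hpos _).ne' fun e he => ?_
    have he := Finset.mem_range.1 he
    rw [map_mul]
    refine ((mul_le_of_le_one_left' (hχ _)).trans
      (cz_iter_s10 v q n hq hn θ α hθ hα e i).1).trans_lt ?_
    refine hmono ((Nat.div_le_div_right ?_).trans_lt (cz_div_lt _ _ hn hdvd'))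
    omega

end helpers

theorem cz_indep (q : ℕ) (hq : 2 ≤ q) (Fq : Type*) [Field Fq] (n : ℕ) (hn : 1 ≤ n)
    {ι : Type*} (s : Finset ι) (π : ι → Polynomial Fq) (hm : ∀ i, (π i).Monic)
    (hirr : ∀ i, Irreducible (π i)) (hinj : Function.Injective π) (a : ι → Polynomial Fq)
    (h : ∑ i ∈ s, carlitzAct q n RatFunc.X (algebraMap Fq (RatFunc Fq)) (a i)
          (lastVec n ((algebraMap (Polynomial Fq) (RatFunc Fq) (π i))⁻¹)) = 0) :
    ∀ i ∈ s, a i = 0 := by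
  classical
  intro j hj
  by_contra ha
  let w : IsDedekindDomain.HeightOneSpectrum (Polynomial Fq) :=
    ⟨Ideal.span {π j}, (Ideal.span_singleton_prime (hirr j).ne_zero).2 (hirr j).prime,
      by simpa using (hirr j).ne_zero⟩
  let v := w.valuation (RatFunc Fq)
  have hle : ∀ r : Polynomial Fq, v (algebraMap _ _ r) ≤ 1 := fun r => w.valuation_le_one r
  have hχ : ∀ c, v (algebraMap Fq (RatFunc Fq) c) ≤ 1 := fun c => by
    rw [IsScalarTower.algebraMap_apply Fq (Polynomial Fq) (RatFunc Fq)]; exact hle _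
  have hθ : v RatFunc.X ≤ 1 := by rw [← RatFunc.algebraMap_X]; exact hle _
  have hne : ∀ i, algebraMap (Polynomial Fq) (RatFunc Fq) (π i) ≠ 0 := fun i => by
    simpa using (hirr i).ne_zero
  have hα : 1 < v (algebraMap (Polynomial Fq) (RatFunc Fq) (π j))⁻¹ := by
    rw [map_inv₀]
    refine (one_lt_inv₀ (zero_lt_iff.2 (by simpa using (hirr j).ne_zero))).2 ?_
    exact (w.valuation_lt_one_iff_mem _).2 (Ideal.mem_span_singleton_self _)
  have hoth : ∀ i, i ≠ j → v (algebraMap (Polynomial Fq) (RatFunc Fq) (π i))⁻¹ ≤ 1 := by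
    intro i hij
    rw [map_inv₀]
    refine (inv_le_one₀ (zero_lt_iff.2 (by simpa using (hirr i).ne_zero))).2 ?_
    by_contra hlt
    have hmem := (w.valuation_lt_one_iff_mem _).1 (not_le.1 hlt)
    have hdvd : π j ∣ π i := Ideal.mem_span_singleton.1 hmem
    exact hij (hinj (Polynomial.eq_of_monic_of_associated (hm i) (hm j)
      ((hirr j).associated_of_dvd (hirr i) hdvd).symm))
  obtain ⟨i₀, hi₀⟩ := cz_act_pole v q n hq hn RatFunc.X _ _ hχ hθ hα (a j) ha
  have h0 := congrFun h i₀
  rw [← Finset.add_sum_erase s _ hj, Pi.add_apply, Finset.sum_apply, Pi.zero_apply] at h0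
  rw [eq_neg_of_add_eq_zero_left h0, Valuation.map_neg] at hi₀
  refine absurd hi₀ (not_lt.2 (v.map_sum_le fun i hi => ?_))
  refine cz_act_integral v q n _ _ hχ hθ _ (fun k => ?_) _ _
  unfold lastVec
  split_ifs
  · exact hoth i (Finset.ne_of_mem_erase hi)
  · simp

theorem cz_infinite (Fq : Type*) [Field Fq] :
    {f : Polynomial Fq | f.Monic ∧ Irreducible f}.Infinite := by
  intro hfin
  have hM : (∏ f ∈ hfin.toFinset, f).Monic :=
    Polynomial.monic_prod_of_monic _ _ fun f hf => ((hfin.mem_toFinset).1 hf).1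
  have hdeg : (Polynomial.X * ∏ f ∈ hfin.toFinset, f + 1 : Polynomial Fq).natDegree ≠ 0 := by
    rw [← Polynomial.C_1, Polynomial.natDegree_add_C, Polynomial.natDegree_X_mul hM.ne_zero]
    omega
  obtain ⟨g, hg1, hg2, hg3⟩ :=
    Polynomial.exists_monic_irreducible_factor _ (Polynomial.not_isUnit_of_natDegree_pos _ (Nat.pos_of_ne_zero hdeg))
  have : g ∣ Polynomial.X * ∏ f ∈ hfin.toFinset, f :=
    (Finset.dvd_prod_of_mem (fun f => f) (hfin.mem_toFinset.2 ⟨hg1, hg2⟩)).mul_left _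
  exact hg2.not_isUnit (isUnit_of_dvd_one ((dvd_add_right this).1 hg3))

/-- The points `(0,…,0,π^{−1}) ∈ C^{⊗n}(𝔽_q(θ))`, indexed by monic irreducible
`π ∈ 𝔽_q[θ]`, are linearly independent over `𝔽_q[t]`; in particular `C^{⊗n}(𝔽_q(θ))`
contains a countably infinite `𝔽_q[t]`-linearly independent family of points. -/
theorem carlitz_inverse_primes_independent
    (p q e : ℕ) (hp : p.Prime) (he : 0 < e) (hq : q = p ^ e)
    (Fq : Type*) [Field Fq] [Fintype Fq] (hFq : Fintype.card Fq = q)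
    (n : ℕ) (hn : 1 ≤ n) :
    (∀ (ℓ : ℕ) (π : Fin ℓ → Polynomial Fq), (∀ i, (π i).Monic) → (∀ i, Irreducible (π i)) →
      Function.Injective π →
      ∀ a : Fin ℓ → Polynomial Fq,
        ∑ i : Fin ℓ, carlitzAct q n RatFunc.X (algebraMap Fq (RatFunc Fq)) (a i)
          (lastVec n ((algebraMap (Polynomial Fq) (RatFunc Fq) (π i))⁻¹)) = 0 →
        ∀ i, a i = 0) ∧
    ∃ P : ℕ → (Fin n → RatFunc Fq), Function.Injective P ∧
      ∀ (s : Finset ℕ) (a : ℕ → Polynomial Fq),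
        ∑ i ∈ s, carlitzAct q n RatFunc.X (algebraMap Fq (RatFunc Fq)) (a i) (P i) = 0 →
        ∀ i ∈ s, a i = 0 := by
  have hq2 : 2 ≤ q := by
    rw [← hFq]; exact Fintype.one_lt_card
  refine ⟨fun ℓ π hm hirr hinj a h i =>
    cz_indep q hq2 Fq n hn Finset.univ π hm hirr hinj a h i (Finset.mem_univ i), ?_⟩
  have := (cz_infinite Fq).to_subtype
  let E := Infinite.natEmbedding {f : Polynomial Fq | f.Monic ∧ Irreducible f}
  have hE : Function.Injective (fun i => (E i : Polynomial Fq)) :=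
    Subtype.val_injective.comp E.injective
  refine ⟨fun i => lastVec n ((algebraMap (Polynomial Fq) (RatFunc Fq) (E i : Polynomial Fq))⁻¹),
    fun i j hij => ?_, fun s a h => ?_⟩
  · have h1 := congrFun hij ⟨n - 1, by omega⟩
    simp only [lastVec, if_true] at h1
    exact hE (RatFunc.algebraMap_injective Fq (inv_injective h1))
  · exact cz_indep q hq2 Fq n hn s (fun i => (E i : Polynomial Fq)) (fun i => (E i).2.1)
      (fun i => (E i).2.2) hE a h
end

section
/- Let L be a finite extension of the rational function field 𝔽_q(θ), let n ≥ 1, and let P_1,…,P_ℓ ∈ C^{⊗n}(L) be distinct nonzero points. For each place v of L set C_v := min( min_{1≤i≤ℓ} ord_v(P_i) + (n−1)·min(0, v(θ)) , ⌈n/(q−1)⌉·min(0, v(θ)) ), where ord_v(P_i) is the minimum of v over the coordinates of P_i, and let ℒ := { f ∈ L : v(f) ≥ C_v for every place v of L }. Assume the 𝔽_q-subspace ℒ of L is finite-dimensional over 𝔽_q, of dimension d (this holds by Riemann–Roch). Let G := { (a_1,…,a_ℓ) ∈ 𝔽_q[t]^ℓ : a_1·P_1 + ⋯ + a_ℓ·P_ℓ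 = 0 in C^{⊗n}(L) }. Then there exist finitely many tuples m_1,…,m_ν ∈ G, each of whose ℓ components has degree at most n(d+ℓ) in t, such that G equals the 𝔽_q[t]-span of m_1,…,m_ν. -/
open Polynomial

/-- `ord_v` of a point of `C^{⊗n}`: the minimum of `v` over its coordinates. -/
noncomputable def ordPt {K : Type*} [Field K] {n : ℕ} (w : AddVal K) (P : Fin n → K) :
    WithTop ℤ :=
  Finset.univ.inf fun i => w.v (P i)

/-- A place of a finite extension `L` of the rational function field `𝔽_q(θ)`: an additive
valuation on `L` that vanishes on all nonzero constants from `𝔽_q` and attains the value `1`. -/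
structure Place (Fq L : Type*) [Field Fq] [Field L] [Algebra (RatFunc Fq) L] extends
    AddVal L where
  const_zero : ∀ c : Fq, c ≠ 0 →
    v (algebraMap (RatFunc Fq) L (algebraMap Fq (RatFunc Fq) c)) = 0
  exists_one : ∃ x : L, v x = 1

/-- The element `θ` of `L`, i.e. the image in `L` of the variable of `𝔽_q(θ)`. -/
noncomputable def thetaL (Fq L : Type*) [Field Fq] [Field L] [Algebra (RatFunc Fq) L] : L :=
  algebraMap (RatFunc Fq) L RatFunc.X

/-- The canonical ring homomorphism `𝔽_q → L`. -/
noncomputable def constMap (Fq L : Type*) [Field Fq] [Field L] [Algebra (RatFunc Fq) L] :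
    Fq →+* L :=
  (algebraMap (RatFunc Fq) L).comp (algebraMap Fq (RatFunc Fq))

theorem det_natDegree_le' {k : Type*} [Field k] {κ : Type*} [Fintype κ] [DecidableEq κ]
    (B : Matrix κ κ k[X]) (n : ℕ) (h : ∀ i j, (B i j).natDegree ≤ n) :
    B.det.natDegree ≤ n * Fintype.card κ := by
  rw [Matrix.det_apply]
  refine natDegree_sum_le_of_forall_le _ _ fun σ _ => ?_
  refine (natDegree_smul_le _ _).trans ?_
  refine (natDegree_prod_le _ _).trans ?_
  refine (Finset.sum_le_card_nsmul _ _ n fun i _ => h _ _).trans ?_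
  simp [mul_comm]

theorem select_minor {K : Type*} [Field K] {M : Type*} [Fintype M] {β : Type*}
    (A : β → M → K) : ∃ (r : ℕ) (ρ : Fin r → β) (I : Fin r → M),
      (Matrix.of fun a b => A (ρ a) (I b)).det ≠ 0 ∧
      ∀ x : M → K, (∀ a, ∑ j, A (ρ a) j * x j = 0) → ∀ b, ∑ j, A b j * x j = 0 := by
  classical
  obtain ⟨κ, a, ha, hspan, hli⟩ := exists_linearIndependent' K A
  have : Finite κ := hli.finite
  let := Fintype.ofFinite κ
  let R : Matrix κ M K := Matrix.of fun i j => A (a i) j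
  have hr : R.rank = Fintype.card κ := LinearIndependent.rank_matrix hli
  obtain ⟨κ', a', ha', hspan', hli'⟩ := exists_linearIndependent' K R.col
  have : Finite κ' := hli'.finite
  let := Fintype.ofFinite κ'
  have hc : Fintype.card κ' = Fintype.card κ := by
    rw [← hr, Matrix.rank_eq_finrank_span_cols, ← hspan', finrank_span_eq_card hli']
  let e := (Fintype.equivFin κ).symm
  let e' := (Fintype.equivFinOfCardEq hc).symm
  refine ⟨Fintype.card κ, a ∘ e, a' ∘ e', ?_, ?_⟩
  · have h1 : LinearIndependent K (Matrix.of fun x y => A (a x) (a' (e' (e.symm y)))).col := 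
      hli'.comp (fun y => e' (e.symm y)) (e'.injective.comp e.symm.injective)
    have h2 := Matrix.linearIndependent_cols_iff_isUnit.1 h1
    rw [Matrix.isUnit_iff_isUnit_det] at h2
    have h3 := h2.ne_zero
    rw [← Matrix.det_submatrix_equiv_self e] at h3
    convert h3 using 2
    ext x y
    simp
  · intro x hx b
    have hb : A b ∈ Submodule.span K (Set.range (A ∘ a)) := by
      rw [hspan]; exact Submodule.subset_span ⟨b, rfl⟩
    let f : (M → K) →ₗ[K] K := Fintype.linearCombination K x
    have hf : ∀ y, f y = ∑ j, y j * x j := fun y => by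
      simp [f, Fintype.linearCombination_apply]
    have : Submodule.span K (Set.range (A ∘ a)) ≤ LinearMap.ker f := by
      rw [Submodule.span_le]
      rintro _ ⟨i, rfl⟩
      have := hx (e.symm i)
      simp only [SetLike.mem_coe, LinearMap.mem_ker, hf]
      simpa using this
    have := this hb
    rwa [LinearMap.mem_ker, hf] at this

theorem kernel_gen {k : Type*} [Field k] {M : Type*} [Fintype M] {β : Type*} (n : ℕ)
    (A : β → M → k[X]) (hA : ∀ b j, (A b j).natDegree ≤ n) (x : M → k[X])
    (hx : ∀ b, ∑ j, A b j * x j = 0) :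
    x ∈ Submodule.span k[X] {y : M → k[X] | (∀ b, ∑ j, A b j * y j = 0) ∧
      ∀ j, (y j).natDegree ≤ n * Fintype.card M} := by
  classical
  obtain ⟨r, ρ, I₀, hdet₀, hker₀⟩ := select_minor
    (fun b j => algebraMap k[X] (RatFunc k) (A b j))
  have hinj := IsFractionRing.injective k[X] (RatFunc k)
  have hker : ∀ x : M → k[X], (∀ a, ∑ j, A (ρ a) j * x j = 0) → ∀ b, ∑ j, A b j * x j = 0 := by
    intro x hx b
    apply hinj
    have := hker₀ (fun j => algebraMap k[X] (RatFunc k) (x j)) (fun a => by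
      have := congrArg (algebraMap k[X] (RatFunc k)) (hx a)
      simpa using this) b
    simpa using this
  let B : (Fin r → M) → Matrix (Fin r) (Fin r) k[X] := fun I => Matrix.of fun a b => A (ρ a) (I b)
  have hB₀ : (B I₀).det ≠ 0 := by
    intro h
    apply hdet₀
    have := congrArg (algebraMap k[X] (RatFunc k)) h
    rw [RingHom.map_det, map_zero] at this
    exact this
  have : Nonempty (Fin r → M) := ⟨I₀⟩
  obtain ⟨I, hI⟩ := Finite.exists_max (fun I : Fin r → M => (B I).det.degree)
  set D := (B I).det with hD
  have hD0 : D ≠ 0 := by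
    intro h
    have := hI I₀
    rw [h, degree_zero, le_bot_iff, degree_eq_bot] at this
    exact hB₀ this
  have hIinj : Function.Injective I := by
    intro a b hab
    by_contra hne
    exact hD0 (Matrix.det_zero_of_column_eq hne (fun i => by simp [B, hab]))
  have hrM : r ≤ Fintype.card M := by
    simpa using Fintype.card_le_of_injective I hIinj
  have hDdeg : D.natDegree ≤ n * Fintype.card M := by
    refine (det_natDegree_le' (B I) n (fun i j => hA _ _)).trans ?_
    simpa using Nat.mul_le_mul_left n hrM
  -- Cramer
  let cr : M → Fin r → k[X] := fun j => (B I).cramer (fun a => A (ρ a) j)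
  have hcr : ∀ j a, (cr j a).degree ≤ D.degree := by
    intro j a
    have : cr j a = (B (Function.update I a j)).det := by
      simp only [cr, Matrix.cramer_apply]
      congr 1
      ext s t
      by_cases h : t = a
      · subst h; simp [B]
      · simp [B, h]
    rw [this]
    exact hI _
  have hsplit : ∀ (z : M → k[X]) (a : Fin r), ∑ j, A (ρ a) j * z j =
      ∑ b, A (ρ a) (I b) * z (I b) + ∑ j with j ∉ Set.range I, A (ρ a) j * z j := by
    intro z a
    rw [← Finset.sum_filter_add_sum_filter_not Finset.univ (fun j => j ∈ Set.range I)]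
    congr 1
    rw [← Finset.sum_image (f := fun j => A (ρ a) j * z j) (s := Finset.univ) (g := I)
      (fun x _ y _ h => hIinj h)]
    apply Finset.sum_congr _ (fun _ _ => rfl)
    ext j; simp
  -- the vectors y_j
  let y : M → M → k[X] := fun j => Pi.single j D - ∑ b, Pi.single (I b) (cr j b)
  have hyker : ∀ j, ∀ b, ∑ i, A b i * y j i = 0 := by
    intro j
    apply hker
    intro a
    have h1 := congrFun (Matrix.mulVec_cramer (B I) (fun a => A (ρ a) j)) a
    simp only [Matrix.mulVec, dotProduct, Pi.smul_apply, smul_eq_mul] at h1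
    simp only [y, Pi.sub_apply, Finset.sum_apply, mul_sub, Finset.sum_sub_distrib, Finset.mul_sum]
    rw [Finset.sum_comm]
    simp only [Pi.single_apply, mul_ite, mul_zero, Finset.sum_ite_eq', Finset.mem_univ, if_true]
    rw [sub_eq_zero, mul_comm]
    exact h1.symm
  have hydeg : ∀ j i, (y j i).natDegree ≤ n * Fintype.card M := by
    intro j i
    refine le_trans (natDegree_le_natDegree ?_) hDdeg
    simp only [y, Pi.sub_apply, Finset.sum_apply]
    refine (degree_sub_le _ _).trans (max_le ?_ ?_)
    · simp only [Pi.single_apply]; split_ifs <;> simp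
    · refine (degree_sum_le _ _).trans (Finset.sup_le fun b _ => ?_)
      simp only [Pi.single_apply]; split_ifs
      · exact hcr _ _
      · simp
  have hyj : ∀ j i, j ∉ Set.range I → i ∉ Set.range I → y j i = if i = j then D else 0 := by
    intro j i hj hi
    simp only [y, Pi.sub_apply, Finset.sum_apply, Pi.single_apply]
    rw [Finset.sum_eq_zero, sub_zero]
    intro b _
    rw [if_neg]
    rintro rfl
    exact hi ⟨b, rfl⟩
  let z : M → k[X] := x - ∑ j with j ∉ Set.range I, (x j / D) • y j
  have hxz : x = z + ∑ j with j ∉ Set.range I, (x j / D) • y j := by simp [z]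
  rw [hxz]
  refine Submodule.add_mem _ (Submodule.subset_span ?_)
    (Submodule.sum_mem _ fun j _ => Submodule.smul_mem _ _ (Submodule.subset_span ⟨hyker j, hydeg j⟩))
  have hzker : ∀ b, ∑ j, A b j * z j = 0 := by
    intro b
    simp only [z, Pi.sub_apply, Finset.sum_apply, mul_sub, Finset.sum_sub_distrib, hx,
      Finset.mul_sum, Pi.smul_apply, smul_eq_mul]
    rw [Finset.sum_comm, zero_sub, neg_eq_zero]
    apply Finset.sum_eq_zero
    intro j _
    have := congrArg (fun s => (x j / D) * s) (hyker j b)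
    simp only [Finset.mul_sum, mul_zero] at this
    rw [← this]
    exact Finset.sum_congr rfl fun i _ => by ring
  have hz1 : ∀ j, j ∉ Set.range I → (z j).degree < D.degree := by
    intro j hj
    have : z j = x j % D := by
      simp only [z, Pi.sub_apply, Finset.sum_apply, Pi.smul_apply, smul_eq_mul]
      rw [Finset.sum_eq_single j]
      · rw [hyj j j hj hj, if_pos rfl, EuclideanDomain.mod_eq_sub_mul_div, mul_comm]
      · intro i hi hij
        rw [hyj i j (by simpa using hi) hj, if_neg hij.symm, mul_zero]
      · intro h; simp at h; exact absurd h (by simpa using hj)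
    rw [this]
    exact degree_mod_lt _ hD0
  refine ⟨hzker, fun j => le_trans (natDegree_le_natDegree (le_of_lt ?_)) hDdeg⟩
  by_cases hj : j ∉ Set.range I
  · exact hz1 j hj
  push Not at hj
  obtain ⟨a, rfl⟩ := hj
  have h1 : (B I).mulVec (fun b => z (I b)) =
      - ∑ j with j ∉ Set.range I, z j • (fun a => A (ρ a) j) := by
    ext1 a
    have := hzker (ρ a)
    rw [hsplit, add_eq_zero_iff_eq_neg] at this
    simp only [Matrix.mulVec, dotProduct, Pi.neg_apply, Finset.sum_apply, Pi.smul_apply, smul_eq_mul]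
    refine this.trans (congrArg _ (Finset.sum_congr rfl fun _ _ => mul_comm _ _))
  have h2 : D * z (I a) = - ∑ j with j ∉ Set.range I, z j * cr j a := by
    have h3 := congrArg (fun u => (B I).cramer u a) h1
    simp only [map_neg, map_sum, map_smul, Pi.neg_apply, Finset.sum_apply, Pi.smul_apply, smul_eq_mul] at h3
    rw [← h3, Matrix.cramer_eq_adjugate_mulVec, Matrix.mulVec_mulVec, Matrix.adjugate_mul]
    simp [Matrix.smul_mulVec, hD]
  have h4 : (D * z (I a)).degree < D.degree + D.degree := by
    rw [h2, degree_neg]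
    refine (degree_sum_le _ _).trans_lt ((Finset.sup_lt_iff ?_).2 fun j hj => ?_)
    · rw [← degree_mul]; exact bot_lt_iff_ne_bot.2 (by simpa [degree_eq_bot] using hD0)
    · have hj' := hz1 j (by simpa using hj)
      rw [degree_mul]
      by_cases h0 : cr j a = 0
      · rw [h0, degree_zero, WithBot.add_bot, ← degree_mul]
        exact bot_lt_iff_ne_bot.2 (by simpa [degree_eq_bot] using hD0)
      · exact WithBot.add_lt_add_of_lt_of_le (by simpa [degree_eq_bot] using h0) hj' (hcr j a)
  rw [degree_mul] at h4
  exact lt_of_add_lt_add_left h4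

noncomputable def ctTwist {L : Type*} [Field L] (n : ℕ) (θ : L) (τ : L →+* L) (g : L[X]) : L[X] :=
  (X - C θ) ^ n * g - g.map τ

noncomputable def ctPoly {L : Type*} [Field L] (n : ℕ) (θ : L) (x : Fin n → L) : L[X] :=
  ∑ i : Fin n, C (x i) * (X - C θ) ^ (n - 1 - (i : ℕ))

theorem ctTwist_add {L : Type*} [Field L] (n : ℕ) (θ : L) (τ : L →+* L) (g h : L[X]) :
    ctTwist n θ τ (g + h) = ctTwist n θ τ g + ctTwist n θ τ h := by
  simp only [ctTwist, Polynomial.map_add]; ring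

theorem ctTwist_sum {L : Type*} [Field L] (n : ℕ) (θ : L) (τ : L →+* L) {ι : Type*} (s : Finset ι)
    (g : ι → L[X]) : ctTwist n θ τ (∑ i ∈ s, g i) = ∑ i ∈ s, ctTwist n θ τ (g i) := by
  simp only [ctTwist, Polynomial.map_sum, Finset.mul_sum, Finset.sum_sub_distrib]

theorem ctTwist_mul {Fq L : Type*} [Field Fq] [Field L] (n : ℕ) (θ : L) (τ : L →+* L)
    (χ : Fq →+* L) (hχ : ∀ c, τ (χ c) = χ c) (a : Fq[X]) (g : L[X]) :
    ctTwist n θ τ (a.map χ * g) = a.map χ * ctTwist n θ τ g := by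
  have : (a.map χ).map τ = a.map χ := by
    rw [Polynomial.map_map]; congr 1; ext c; exact hχ c
  simp only [ctTwist, Polynomial.map_mul, this]; ring

theorem ctPoly_sum_smul {L : Type*} [Field L] (n : ℕ) (θ : L) {ι : Type*} (s : Finset ι)
    (c : ι → L) (x : ι → Fin n → L) :
    ctPoly n θ (∑ i ∈ s, c i • x i) = ∑ i ∈ s, C (c i) * ctPoly n θ (x i) := by
  simp only [ctPoly, Finset.sum_apply, Pi.smul_apply, smul_eq_mul, map_sum, Finset.sum_mul,
    Finset.mul_sum, C_mul]
  rw [Finset.sum_comm]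
  simp only [mul_assoc]

theorem ctPoly_sum {L : Type*} [Field L] (n : ℕ) (θ : L) {ι : Type*} (s : Finset ι)
    (x : ι → Fin n → L) :
    ctPoly n θ (∑ i ∈ s, x i) = ∑ i ∈ s, ctPoly n θ (x i) := by
  have := ctPoly_sum_smul n θ s (fun _ => 1) x
  simpa using this

theorem ctPoly_phi {L : Type*} [Field L] (q n : ℕ) (hn : 1 ≤ n) (θ : L) (τ : L →+* L)
    (hτ : ∀ x, τ x = x ^ q) (x : Fin n → L) :
    ctPoly n θ (carlitzPhi q n θ x) =
      X * ctPoly n θ x - ctTwist n θ τ (C (x ⟨0, hn⟩)) := by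
  obtain ⟨m, rfl⟩ : ∃ m, n = m + 1 := ⟨n - 1, by omega⟩
  have h1 : X * ctPoly (m + 1) θ x = ∑ i : Fin (m + 1), C (θ * x i) * (X - C θ) ^ (m - (i : ℕ)) +
      ∑ i : Fin (m + 1), C (x i) * (X - C θ) ^ (m - (i : ℕ) + 1) := by
    rw [ctPoly, Finset.mul_sum, ← Finset.sum_add_distrib]
    refine Finset.sum_congr rfl fun i _ => ?_
    simp only [C_mul, Nat.add_sub_cancel]
    ring
  have h2 : ctPoly (m + 1) θ (carlitzPhi q (m + 1) θ x) =
      ∑ i : Fin (m + 1), C (θ * x i) * (X - C θ) ^ (m - (i : ℕ)) +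
      ∑ i : Fin (m + 1), C (if h : (i : ℕ) + 1 < m + 1 then x ⟨(i : ℕ) + 1, h⟩
        else (x ⟨0, hn⟩) ^ q) * (X - C θ) ^ (m - (i : ℕ)) := by
    rw [ctPoly, ← Finset.sum_add_distrib]
    refine Finset.sum_congr rfl fun i _ => ?_
    simp only [carlitzPhi, C_add, Nat.add_sub_cancel]
    ring
  rw [h1, h2, add_sub_assoc]
  congr 1
  rw [Fin.sum_univ_castSucc, Fin.sum_univ_succ (n := m) (f := fun i => C (x i) * (X - C θ) ^ (m - (i : ℕ) + 1))]
  simp only [ctTwist, Polynomial.map_C, hτ]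
  have h3 : ∀ i : Fin m, C (if h : ((i.castSucc : Fin (m+1)) : ℕ) + 1 < m + 1 then
      x ⟨((i.castSucc : Fin (m+1)) : ℕ) + 1, h⟩ else (x ⟨0, hn⟩) ^ q) *
        (X - C θ) ^ (m - ((i.castSucc : Fin (m+1)) : ℕ)) =
      C (x i.succ) * (X - C θ) ^ (m - ((i.succ : Fin (m + 1)) : ℕ) + 1) := by
    intro i
    have hi := i.isLt
    rw [dif_pos (by simp)]
    have e : m - ((i.castSucc : Fin (m+1)) : ℕ) = m - ((i.succ : Fin (m + 1)) : ℕ) + 1 := by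
      simp; omega
    rw [e]
    rfl
  rw [Finset.sum_congr rfl fun i _ => h3 i]
  simp
  ring

theorem ctPoly_iter {Fq L : Type*} [Field Fq] [Field L] (q n : ℕ) (hn : 1 ≤ n) (θ : L) (τ : L →+* L)
    (χ : Fq →+* L) (hχ : ∀ c, τ (χ c) = χ c)
    (hτ : ∀ x, τ x = x ^ q) (x : Fin n → L) (i : ℕ) :
    ∃ g, X ^ i * ctPoly n θ x = ctPoly n θ ((carlitzPhi q n θ)^[i] x) + ctTwist n θ τ g := by
  induction i with
  | zero => exact ⟨0, by simp [ctTwist]⟩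
  | succ i ih =>
    obtain ⟨g, hg⟩ := ih
    refine ⟨C (((carlitzPhi q n θ)^[i] x) ⟨0, hn⟩) + (X : Fq[X]).map χ * g, ?_⟩
    rw [Function.iterate_succ_apply', ctPoly_phi q n hn θ τ hτ, ctTwist_add,
      ctTwist_mul n θ τ χ hχ, Polynomial.map_X, pow_succ', mul_assoc, hg]
    ring

theorem ctPoly_act {Fq L : Type*} [Field Fq] [Field L] (q n : ℕ) (hn : 1 ≤ n) (θ : L) (τ : L →+* L)
    (χ : Fq →+* L) (hχ : ∀ c, τ (χ c) = χ c)
    (hτ : ∀ x, τ x = x ^ q) (x : Fin n → L) (a : Fq[X]) :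
    ∃ g, a.map χ * ctPoly n θ x = ctPoly n θ (carlitzAct q n θ χ a x) + ctTwist n θ τ g := by
  choose g hg using ctPoly_iter q n hn θ τ χ hχ hτ x
  refine ⟨∑ i ∈ Finset.range (a.natDegree + 1), (C (a.coeff i)).map χ * g i, ?_⟩
  rw [carlitzAct, ctPoly_sum_smul, ctTwist_sum, ← Finset.sum_add_distrib]
  conv_lhs => rw [a.as_sum_range_C_mul_X_pow, Polynomial.map_sum, Finset.sum_mul]
  refine Finset.sum_congr rfl fun i _ => ?_
  rw [ctTwist_mul n θ τ χ hχ, Polynomial.map_mul, Polynomial.map_pow, map_X, map_C, mul_assoc, hg]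
  ring

theorem ctPoly_degree {L : Type*} [Field L] (n : ℕ) (hn : 1 ≤ n) (θ : L) (x : Fin n → L) :
    (ctPoly n θ x).natDegree ≤ n - 1 := by
  refine natDegree_sum_le_of_forall_le _ _ fun i _ => ?_
  refine (natDegree_C_mul_le _ _).trans ?_
  rw [natDegree_pow, natDegree_X_sub_C]; omega

theorem ctPoly_eq_zero {L : Type*} [Field L] (n : ℕ) (θ : L) (x : Fin n → L)
    (h : ctPoly n θ x = 0) : x = 0 := by
  ext j
  have h1 := congrArg (fun f => (f.comp (X + C θ)).coeff (n - 1 - (j : ℕ))) h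
  simp only [ctPoly, Polynomial.sum_comp, mul_comp, C_comp, pow_comp, sub_comp, X_comp,
    add_sub_cancel_right, finsetSum_coeff, zero_comp, coeff_zero, coeff_C_mul, coeff_X_pow] at h1
  rw [Finset.sum_eq_single j] at h1
  · simpa using h1
  · intro i _ hij
    rw [if_neg, mul_zero]
    intro e
    apply hij
    ext
    have := i.isLt
    have := j.isLt
    omega
  · simp

theorem ctTwist_inj {L : Type*} [Field L] (n : ℕ) (hn : 1 ≤ n) (θ : L) (τ : L →+* L)
    (x : Fin n → L) (g : L[X]) (h : ctPoly n θ x = ctTwist n θ τ g) : x = 0 := by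
  by_cases hg : g = 0
  · apply ctPoly_eq_zero n θ x
    rw [h, hg]; simp [ctTwist]
  exfalso
  have hX : (X - C θ : L[X]) ^ n ≠ 0 := pow_ne_zero _ (X_sub_C_ne_zero θ)
  have h1 : ((X - C θ) ^ n * g).natDegree = n + g.natDegree := by
    rw [natDegree_mul hX hg, natDegree_pow, natDegree_X_sub_C, mul_one]
  have h2 : (g.map τ).natDegree ≤ g.natDegree := natDegree_map_le
  have h3 : (ctTwist n θ τ g).natDegree = n + g.natDegree := by
    rw [ctTwist, natDegree_sub_eq_left_of_natDegree_lt (by omega), h1]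
  have := ctPoly_degree n hn θ x
  rw [h] at this
  omega

theorem ct_rel_iff {Fq L : Type*} [Field Fq] [Field L] (q n : ℕ) (hn : 1 ≤ n) (θ : L) (τ : L →+* L)
    (χ : Fq →+* L) (hχ : ∀ c, τ (χ c) = χ c)
    (hτ : ∀ x, τ x = x ^ q) {ℓ : ℕ} (P : Fin ℓ → Fin n → L) (a : Fin ℓ → Fq[X]) :
    ∑ i : Fin ℓ, carlitzAct q n θ χ (a i) (P i) = 0 ↔
    ∃ g, ∑ i, (a i).map χ * ctPoly n θ (P i) = ctTwist n θ τ g := by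
  choose g hg using fun i => ctPoly_act q n hn θ τ χ hχ hτ (P i) (a i)
  have h0 : ∑ i, (a i).map χ * ctPoly n θ (P i) =
      ctPoly n θ (∑ i : Fin ℓ, carlitzAct q n θ χ (a i) (P i)) + ctTwist n θ τ (∑ i, g i) := by
    rw [ctPoly_sum, ctTwist_sum, ← Finset.sum_add_distrib]
    exact Finset.sum_congr rfl fun i _ => hg i
  rw [h0]
  constructor
  · intro h
    refine ⟨∑ i, g i, ?_⟩
    rw [h]; simp [ctPoly]
  · rintro ⟨f, hf⟩
    apply ctTwist_inj n hn θ τ _ (f - ∑ i, g i)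
    have := ctTwist_add n θ τ (f - ∑ i, g i) (∑ i, g i)
    rw [sub_add_cancel] at this
    rw [this] at hf
    exact add_right_cancel hf

/-! Valuations. -/

def ctBd {L : Type*} [Field L] (w : AddVal L) (s : WithTop ℤ) (f : L[X]) : Prop :=
  ∀ k, s ≤ w.v (f.coeff k)

theorem AddVal.v_zero' {L : Type*} [Field L] (w : AddVal L) : w.v 0 = ⊤ := (w.eq_top_iff 0).2 rfl

theorem AddVal.v_one' {L : Type*} [Field L] (w : AddVal L) : w.v 1 = 0 := by
  have h := w.map_mul 1 1
  have h1 : w.v 1 ≠ ⊤ := fun h => one_ne_zero ((w.eq_top_iff 1).1 h)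
  lift w.v 1 to ℤ using h1 with u hu
  rw [mul_one, ← hu] at h
  norm_cast at h ⊢
  omega

theorem AddVal.v_neg' {L : Type*} [Field L] (w : AddVal L) (x : L) : w.v (-x) = w.v x := by
  have h := w.map_mul (-1) (-1)
  have h1 : w.v (-1) ≠ ⊤ := fun h => (neg_ne_zero.2 one_ne_zero) ((w.eq_top_iff _).1 h)
  have h2 := w.map_mul (-1) x
  rw [neg_mul_neg, mul_one, w.v_one'] at h
  have h3 : w.v (-1) = 0 := by
    lift w.v (-1) to ℤ using h1 with u hu
    norm_cast at h ⊢
    omega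
  rw [h3, zero_add, neg_one_mul] at h2
  exact h2

theorem AddVal.v_pow' {L : Type*} [Field L] (w : AddVal L) (x : L) (k : ℕ) :
    w.v (x ^ k) = k • w.v x := by
  induction k with
  | zero => simp [w.v_one']
  | succ k ih => rw [pow_succ, w.map_mul, ih, succ_nsmul]

theorem AddVal.le_sum' {L : Type*} [Field L] (w : AddVal L) {ι : Type*} (S : Finset ι) (f : ι → L)
    (s : WithTop ℤ) (h : ∀ i ∈ S, s ≤ w.v (f i)) : s ≤ w.v (∑ i ∈ S, f i) := by
  classical
  induction S using Finset.induction_on with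
  | empty => simp [w.v_zero']
  | insert a S ha ih =>
    rw [Finset.sum_insert ha]
    exact (le_min (h a (by simp)) (ih fun i hi => h i (by simp [hi]))).trans (w.add_le _ _)

theorem ctBd.sum {L : Type*} [Field L] {w : AddVal L} {ι : Type*} (S : Finset ι) (f : ι → L[X])
    (s : WithTop ℤ) (h : ∀ i ∈ S, ctBd w s (f i)) : ctBd w s (∑ i ∈ S, f i) := by
  intro k
  rw [finsetSum_coeff]
  exact w.le_sum' _ _ _ fun i hi => h i hi k

theorem ctBd.mul {L : Type*} [Field L] {w : AddVal L} {f g : L[X]}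
    {s t : WithTop ℤ} (hf : ctBd w s f) (hg : ctBd w t g) : ctBd w (s + t) (f * g) := by
  intro k
  rw [coeff_mul]
  refine w.le_sum' _ _ _ fun i hi => ?_
  rw [w.map_mul]
  exact add_le_add (hf _) (hg _)

theorem ctBd.mono {L : Type*} [Field L] {w : AddVal L} {f : L[X]}
    {s t : WithTop ℤ} (hf : ctBd w s f) (hst : t ≤ s) : ctBd w t f := fun k => hst.trans (hf k)

theorem ctBd_C {L : Type*} [Field L] (w : AddVal L) (x : L) : ctBd w (w.v x) (C x) := by
  intro k
  rw [coeff_C]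
  split_ifs
  · exact le_rfl
  · rw [w.v_zero']; exact le_top

theorem ctBd.pow {L : Type*} [Field L] {w : AddVal L} {f : L[X]}
    {s : WithTop ℤ} (hf : ctBd w s f) (k : ℕ) : ctBd w (k • s) (f ^ k) := by
  induction k with
  | zero =>
    have := ctBd_C w 1
    rw [w.v_one'] at this
    simpa using this
  | succ k ih => rw [pow_succ, succ_nsmul]; exact ih.mul hf

theorem ctBd_X_sub_C {L : Type*} [Field L] (w : AddVal L) (θ : L) :
    ctBd w (min 0 (w.v θ)) (X - C θ) := by
  intro k
  rw [coeff_sub, sub_eq_add_neg]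
  refine le_trans (min_le_min ?_ ?_) (w.add_le _ _)
  · rw [coeff_X]; split_ifs
    · rw [w.v_one']
    · rw [w.v_zero']; exact le_top
  · rw [w.v_neg']; exact ctBd_C w θ k

theorem ctBd_map {Fq L : Type*} [Field Fq] [Field L] (w : AddVal L) (χ : Fq →+* L)
    (h : ∀ c, c ≠ 0 → w.v (χ c) = 0) (a : Fq[X]) : ctBd w 0 (a.map χ) := by
  intro k
  rw [coeff_map]
  by_cases h0 : a.coeff k = 0
  · rw [h0, map_zero, w.v_zero']; exact le_top
  · rw [h _ h0]

theorem ctBd_ctPoly {L : Type*} [Field L] (w : AddVal L) (n : ℕ) (θ : L) (x : Fin n → L) :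
    ctBd w (ordPt w x + (n - 1) • min 0 (w.v θ)) (ctPoly n θ x) := by
  refine ctBd.sum _ _ _ fun i _ => ?_
  refine ((ctBd_C w (x i)).mul ((ctBd_X_sub_C w θ).pow _)).mono ?_
  refine add_le_add (Finset.inf_le (Finset.mem_univ i)) ?_
  have hμ : min 0 (w.v θ) ≤ 0 := min_le_left _ _
  generalize min 0 (w.v θ) = μ at hμ
  obtain ⟨c, hc⟩ : ∃ c, n - 1 = (n - 1 - (i : ℕ)) + c := ⟨n - 1 - (n - 1 - (i : ℕ)), by omega⟩
  conv_lhs => rw [hc, add_nsmul]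
  exact (add_le_add le_rfl (nsmul_nonpos hμ c)).trans_eq (add_zero _)

theorem ct_coeff_bound {Fq L : Type*} [Field Fq] [Field L] (w : AddVal L) (q n : ℕ) (hq : 2 ≤ q)
    (θ : L) (τ : L →+* L) (χ : Fq →+* L) (h : ∀ c, c ≠ 0 → w.v (χ c) = 0)
    (hτ : ∀ x, τ x = x ^ q) {ℓ : ℕ} (P : Fin ℓ → Fin n → L) (a : Fin ℓ → Fq[X]) (g : L[X])
    (hg : ∑ i, (a i).map χ * ctPoly n θ (P i) = ctTwist n θ τ g) (c : ℕ) (hc : n ≤ c * (q - 1)) :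
    ctBd w (min ((Finset.univ.inf fun i : Fin ℓ => ordPt w (P i)) + (n - 1) • min 0 (w.v θ))
      (c • min 0 (w.v θ))) g := by
  have hF : ctBd w ((Finset.univ.inf fun i : Fin ℓ => ordPt w (P i)) + (n - 1) • min 0 (w.v θ))
      (∑ i, (a i).map χ * ctPoly n θ (P i)) := by
    refine ctBd.sum _ _ _ fun i _ => ?_
    refine ((ctBd_map w χ h (a i)).mul (ctBd_ctPoly w n θ (P i))).mono ?_
    rw [zero_add]
    exact add_le_add (Finset.inf_le (Finset.mem_univ i)) le_rfl
  rw [hg] at hF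
  generalize ((Finset.univ.inf fun i : Fin ℓ => ordPt w (P i)) + (n - 1) • min 0 (w.v θ)) = A at hF ⊢
  by_cases hg0 : g = 0
  · intro k; rw [hg0, coeff_zero, w.v_zero']; exact le_top
  obtain ⟨k, hk, hmin⟩ := Finset.exists_min_image g.support (fun k => w.v (g.coeff k))
    (by simpa using hg0)
  have hall : ctBd w (w.v (g.coeff k)) g := by
    intro j
    by_cases hj : j ∈ g.support
    · exact hmin j hj
    · rw [notMem_support_iff.1 hj, w.v_zero']; exact le_top
  refine hall.mono ?_
  have h1 := ((ctBd_X_sub_C w θ).pow n).mul hall k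
  have h2 : g.coeff k ^ q = ((X - C θ) ^ n * g).coeff k + -(ctTwist n θ τ g).coeff k := by
    simp only [ctTwist, coeff_sub, coeff_map, hτ]; ring
  have h3 := w.add_le (((X - C θ) ^ n * g).coeff k) (-(ctTwist n θ τ g).coeff k)
  rw [← h2, w.v_neg', w.v_pow'] at h3
  replace h3 := (min_le_min h1 (hF k)).trans h3
  have ho : w.v (g.coeff k) ≠ ⊤ := fun hh => (mem_support_iff.1 hk) ((w.eq_top_iff _).1 hh)
  have hμ : min 0 (w.v θ) ≤ 0 := min_le_left _ _
  clear h1 h2 hall hmin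
  generalize min 0 (w.v θ) = μ at *
  generalize w.v (g.coeff k) = o at *
  lift o to ℤ using ho
  lift μ to ℤ using ne_top_of_le_ne_top (by simp) hμ
  by_contra hcon
  rw [not_le, lt_min_iff] at hcon
  obtain ⟨hA, hcm⟩ := hcon
  norm_cast at hcm hμ
  obtain ⟨r, rfl⟩ : ∃ r, q = r + 1 := ⟨q - 1, by omega⟩
  rw [Nat.add_sub_cancel] at hc
  have hc' : (n : ℤ) ≤ c * r := by exact_mod_cast hc
  have hr : (1 : ℤ) ≤ r := by exact_mod_cast (by omega : 1 ≤ r)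
  simp only [nsmul_eq_mul] at hcm
  have hneg : o < 0 := hcm.trans_le (by nlinarith [Int.natCast_nonneg c])
  rw [min_le_iff] at h3
  rcases h3 with h3 | h3
  · norm_cast at h3
    simp only [nsmul_eq_mul] at h3
    push_cast at h3
    have h4 : (n : ℤ) * μ ≤ r * o := by linarith
    have h5 : (c * r : ℤ) * μ ≤ n * μ := by nlinarith
    have h6 : (r : ℤ) * (c * μ) ≤ r * o := by linarith
    have := le_of_mul_le_mul_left h6 (by linarith)
    omega
  · have h4 : (r + 1) • (o : WithTop ℤ) ≤ o := by
      norm_cast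
      simp only [nsmul_eq_mul]
      push_cast
      nlinarith
    exact absurd hA (not_lt.2 (h3.trans h4))

/-! Descent from `L[X]` to `Fq[X]` by linear functionals. -/

noncomputable def ctDual {Fq L : Type*} [Field Fq] [Field L] [Algebra Fq L]
    (lam : Module.Dual Fq L) (f : L[X]) : Fq[X] :=
  ∑ k ∈ Finset.range (f.natDegree + 1), C (lam (f.coeff k)) * X ^ k

theorem ctDual_coeff {Fq L : Type*} [Field Fq] [Field L] [Algebra Fq L]
    (lam : Module.Dual Fq L) (f : L[X]) (k : ℕ) : (ctDual lam f).coeff k = lam (f.coeff k) := by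
  simp only [ctDual, finsetSum_coeff, coeff_C_mul, coeff_X_pow, mul_ite, mul_one, mul_zero]
  rw [Finset.sum_ite_eq]
  split_ifs with h
  · rfl
  · rw [coeff_eq_zero_of_natDegree_lt, map_zero]
    simpa [Nat.lt_succ_iff] using h

theorem ctDual_natDegree {Fq L : Type*} [Field Fq] [Field L] [Algebra Fq L]
    (lam : Module.Dual Fq L) (f : L[X]) : (ctDual lam f).natDegree ≤ f.natDegree := by
  rw [natDegree_le_iff_coeff_eq_zero]
  intro k hk
  rw [ctDual_coeff, coeff_eq_zero_of_natDegree_lt hk, map_zero]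

theorem ctDual_sum {Fq L : Type*} [Field Fq] [Field L] [Algebra Fq L]
    (lam : Module.Dual Fq L) {ι : Type*} (S : Finset ι) (f : ι → L[X]) (a : ι → Fq[X]) :
    ctDual lam (∑ i ∈ S, (a i).map (algebraMap Fq L) * f i) = ∑ i ∈ S, ctDual lam (f i) * a i := by
  ext k
  rw [ctDual_coeff, finsetSum_coeff, finsetSum_coeff, map_sum]
  refine Finset.sum_congr rfl fun i _ => ?_
  rw [mul_comm (ctDual lam (f i)), coeff_mul, coeff_mul, map_sum]
  refine Finset.sum_congr rfl fun j _ => ?_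
  rw [coeff_map, ← Algebra.smul_def, map_smul, ctDual_coeff, smul_eq_mul]

theorem ctDual_eq_zero {Fq L : Type*} [Field Fq] [Field L] [Algebra Fq L] (f : L[X]) :
    (∀ lam : Module.Dual Fq L, ctDual lam f = 0) ↔ f = 0 := by
  constructor
  · intro h
    ext k
    rw [coeff_zero, ← Module.forall_dual_apply_eq_zero_iff Fq]
    intro lam
    rw [← ctDual_coeff, h, coeff_zero]
  · rintro rfl lam
    ext k
    rw [ctDual_coeff]; simp


/-- The `𝔽_q[t]`-module of linear relations among distinct nonzero points
`P_1,…,P_ℓ ∈ C^{⊗n}(L)` is spanned by finitely many relations whose components have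
degree at most `n(d+ℓ)`, where `d` is the `𝔽_q`-dimension of the Riemann–Roch space `ℒ`. -/
theorem relation_module_generated_in_bounded_degree
    (p q e : ℕ) (hp : p.Prime) (he : 0 < e) (hq : q = p ^ e)
    (Fq : Type*) [Field Fq] [Fintype Fq] (hFq : Fintype.card Fq = q)
    (L : Type*) [Field L] [Algebra (RatFunc Fq) L] [FiniteDimensional (RatFunc Fq) L]
    [Algebra Fq L] [IsScalarTower Fq (RatFunc Fq) L]
    (n : ℕ) (hn : 1 ≤ n) (ℓ : ℕ) (P : Fin ℓ → Fin n → L)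
    (hP0 : ∀ i, P i ≠ 0) (hPinj : Function.Injective P)
    (W : Submodule Fq L)
    (hW : (W : Set L) = {f : L | ∀ w : Place Fq L,
      min ((Finset.univ.inf fun i : Fin ℓ => ordPt w.toAddVal (P i)) +
            (n - 1) • min 0 (w.v (thetaL Fq L)))
          ((⌈(n : ℚ) / ((q : ℚ) - 1)⌉.toNat) • min 0 (w.v (thetaL Fq L))) ≤ w.v f})
    (d : ℕ) [Module.Finite Fq W] (hd : Module.finrank Fq W = d) :
    ∃ (ν : ℕ) (m : Fin ν → (Fin ℓ → Polynomial Fq)),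
      (∀ j, ∑ i : Fin ℓ,
        carlitzAct q n (thetaL Fq L) (constMap Fq L) (m j i) (P i) = 0) ∧
      (∀ j i, (m j i).natDegree ≤ n * (d + ℓ)) ∧
      {a : Fin ℓ → Polynomial Fq |
          ∑ i : Fin ℓ, carlitzAct q n (thetaL Fq L) (constMap Fq L) (a i) (P i) = 0} =
        ↑(Submodule.span (Polynomial Fq) (Set.range m)) := by
  classical
  have hq2 : 2 ≤ q := by rw [← hFq]; exact Fintype.one_lt_card
  have hχ0 : constMap Fq L = algebraMap Fq L := by
    ext c
    exact (IsScalarTower.algebraMap_apply Fq (RatFunc Fq) L c).symm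
  set θ := thetaL Fq L with hθ
  let τ : L →+* L := (FiniteField.frobeniusAlgHom Fq L : L →+* L)
  have hτ : ∀ x, τ x = x ^ q := by
    intro x
    rw [← hFq]; rfl
  have hχ : ∀ c, τ (algebraMap Fq L c) = algebraMap Fq L c := fun c =>
    (FiniteField.frobeniusAlgHom Fq L).commutes c
  rw [hχ0]
  have hiff := ct_rel_iff q n hn θ τ (algebraMap Fq L) hχ hτ P
  set N := n * (d + ℓ) with hN
  let S : Set (Fin ℓ → Fq[X]) := {a | (∑ i : Fin ℓ, carlitzAct q n θ (algebraMap Fq L) (a i) (P i) = 0) ∧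
    ∀ i, (a i).natDegree ≤ N}
  have hc : n ≤ ⌈(n : ℚ) / ((q : ℚ) - 1)⌉.toNat * (q - 1) := by
    have h1 : (n : ℚ) / ((q : ℚ) - 1) ≤ (⌈(n : ℚ) / ((q : ℚ) - 1)⌉.toNat : ℚ) := by
      refine (Int.le_ceil _).trans ?_
      exact_mod_cast Int.self_le_toNat _
    have hq' : (0 : ℚ) < (q : ℚ) - 1 := by
      have : (2 : ℚ) ≤ q := by exact_mod_cast hq2
      linarith
    have hceil := (div_le_iff₀ hq').1 h1
    have h2 : ((q - 1 : ℕ) : ℚ) = (q : ℚ) - 1 := by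
      rw [Nat.cast_sub (by omega)]; simp
    generalize ⌈(n : ℚ) / ((q : ℚ) - 1)⌉.toNat = c at hceil ⊢
    have h3 := hceil.trans_eq (congrArg _ h2.symm)
    exact_mod_cast h3
  have hconst : ∀ (w : Place Fq L) (c : Fq), c ≠ 0 → w.v (algebraMap Fq L c) = 0 := by
    intro w c hc
    rw [← hχ0]; exact w.const_zero c hc
  let bas := Module.finBasisOfFinrankEq Fq W hd
  let F : Fin ℓ ⊕ Fin d → L[X] := Sum.elim (fun i => ctPoly n θ (P i))
    (fun j => - ctTwist n θ τ (C (bas j : L)))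
  have hFdeg : ∀ j, (F j).natDegree ≤ n := by
    rintro (i | j)
    · exact (ctPoly_degree n hn θ (P i)).trans (Nat.sub_le _ _)
    · simp only [F, Sum.elim_inr, natDegree_neg, ctTwist, map_C]
      refine (natDegree_sub_le _ _).trans (max_le ?_ (by simp))
      refine (natDegree_mul_C_le _ _).trans ?_
      rw [natDegree_pow, natDegree_X_sub_C, mul_one]
  have hFsum : ∀ y : Fin ℓ ⊕ Fin d → Fq[X],
      ∑ j, (y j).map (algebraMap Fq L) * F j =
        ∑ i, (y (Sum.inl i)).map (algebraMap Fq L) * ctPoly n θ (P i) -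
        ctTwist n θ τ (∑ j, (y (Sum.inr j)).map (algebraMap Fq L) * C (bas j : L)) := by
    intro y
    rw [Fintype.sum_sum_type, ctTwist_sum, sub_eq_add_neg, ← Finset.sum_neg_distrib]
    congr 1
    refine Finset.sum_congr rfl fun j _ => ?_
    rw [ctTwist_mul n θ τ _ hχ]
    simp [F]
  have hkerF : ∀ y : Fin ℓ ⊕ Fin d → Fq[X],
      (∀ lam : Module.Dual Fq L, ∑ j, ctDual lam (F j) * y j = 0) ↔
      ∑ j, (y j).map (algebraMap Fq L) * F j = 0 := by
    intro y
    rw [← ctDual_eq_zero (Fq := Fq)]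
    simp only [ctDual_sum]
  -- main inclusion
  have hmain : ∀ a : Fin ℓ → Fq[X],
      (∑ i : Fin ℓ, carlitzAct q n θ (algebraMap Fq L) (a i) (P i) = 0) →
      a ∈ Submodule.span Fq[X] S := by
    intro a ha
    obtain ⟨g, hg⟩ := (hiff a).1 ha
    have hgW : ∀ k, g.coeff k ∈ W := by
      intro k
      rw [← SetLike.mem_coe, hW]
      intro w
      exact ct_coeff_bound w.toAddVal q n hq2 θ τ (algebraMap Fq L) (hconst w) hτ P a g hg _ hc k
    let gc : Fin d → Fq[X] := fun j => ∑ k ∈ Finset.range (g.natDegree + 1),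
      C (bas.repr ⟨g.coeff k, hgW k⟩ j) * X ^ k
    have hgc : ∑ j, (gc j).map (algebraMap Fq L) * C (bas j : L) = g := by
      conv_rhs => rw [g.as_sum_range_C_mul_X_pow]
      simp only [gc, Polynomial.map_sum, Finset.sum_mul]
      rw [Finset.sum_comm]
      refine Finset.sum_congr rfl fun k _ => ?_
      have h1 := congrArg (Subtype.val) (bas.sum_repr ⟨g.coeff k, hgW k⟩)
      simp only [Submodule.coe_sum, Submodule.coe_smul, Algebra.smul_def] at h1
      conv_rhs => rw [← h1, map_sum, Finset.sum_mul]
      refine Finset.sum_congr rfl fun j _ => ?_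
      simp only [Polynomial.map_mul, map_C, Polynomial.map_pow, map_X, C_mul]
      ring
    have hx := kernel_gen n (fun (lam : Module.Dual Fq L) j => ctDual lam (F j))
      (fun lam j => (ctDual_natDegree lam _).trans (hFdeg j)) (Sum.elim a gc)
      ((hkerF _).2 (by
        rw [hFsum]
        simp only [Sum.elim_inl, Sum.elim_inr]
        rw [hgc, hg, sub_self]))
    have h2 := Submodule.mem_map_of_mem (f := LinearMap.funLeft Fq[X] Fq[X] (Sum.inl : Fin ℓ → Fin ℓ ⊕ Fin d)) hx
    rw [Submodule.map_span] at h2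
    refine Submodule.span_mono ?_ h2
    rintro _ ⟨y, ⟨hy, hydeg⟩, rfl⟩
    refine ⟨?_, fun i => ?_⟩
    · have h3 := (hkerF y).1 hy
      rw [hFsum, sub_eq_zero] at h3
      exact (hiff _).2 ⟨_, h3⟩
    · have := hydeg (Sum.inl i)
      simp only [Fintype.card_sum, Fintype.card_fin] at this
      rw [hN, add_comm d]
      exact this
  have hfg : (Submodule.span Fq[X] S).FG := IsNoetherian.noetherian _
  obtain ⟨T, hTS, hT⟩ := (Submodule.fg_span_iff_fg_span_finset_subset S).1 hfg
  refine ⟨T.card, fun j => (T.equivFin.symm j : Fin ℓ → Fq[X]),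
    fun j => (hTS (T.equivFin.symm j).2).1, fun j => (hTS (T.equivFin.symm j).2).2, ?_⟩
  have hrange : Set.range (fun j => (T.equivFin.symm j : Fin ℓ → Fq[X])) = (T : Set (Fin ℓ → Fq[X])) := by
    ext a
    constructor
    · rintro ⟨j, rfl⟩; exact (T.equivFin.symm j).2
    · intro ha; exact ⟨T.equivFin ⟨a, ha⟩, by simp⟩
  rw [hrange, ← hT]
  ext a
  refine ⟨fun ha => hmain a ha, fun ha => ?_⟩
  refine (hiff a).2 ?_
  induction ha using Submodule.span_induction with
  | mem x hx => exact (hiff x).1 hx.1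
  | zero => exact ⟨0, by simp [ctTwist]⟩
  | add x y _ _ hx hy =>
    obtain ⟨g, hg⟩ := hx
    obtain ⟨h, hh⟩ := hy
    refine ⟨g + h, ?_⟩
    rw [ctTwist_add, ← hg, ← hh, ← Finset.sum_add_distrib]
    simp [add_mul]
  | smul c x _ hx =>
    obtain ⟨g, hg⟩ := hx
    refine ⟨c.map (algebraMap Fq L) * g, ?_⟩
    rw [ctTwist_mul n θ τ _ hχ, ← hg, Finset.mul_sum]
    simp [mul_assoc]
end
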